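/- (Construction of the E8-singularity equation from the modular curve X(13).) For every z in the upper half-plane ℍ, writing Φj for Φj(x1(z),…,x6(z)) (j = 12, 20, 30), one has Φ20^3 − Φ30^2 = 1728·Φ12^5. -/

import Mathlib

open Complex Finset

noncomputable section

/-- `ζ = exp(2πi/13)`. -/
def zeta13 : ℂ := Complex.exp (2 * Real.pi * Complex.I / 13)

local notation "ζ" => zeta13

/-- The diagonal matrix `T = diag(ζ^7, ζ^11, ζ^8, ζ^6, ζ^2, ζ^5)`. -/
def Tmat : Matrix (Fin 6) (Fin 6) ℂ :=
  Matrix.diagonal ![ζ ^ 7, ζ ^ 11, ζ ^ 8, ζ ^ 6, ζ ^ 2, ζ ^ 5]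

/-- The matrix `S = -(1/√13)·M`. -/
def Smat : Matrix (Fin 6) (Fin 6) ℂ :=
  (-(1 / (Real.sqrt 13 : ℂ))) • Matrix.of
    ![![ζ^12 - ζ, ζ^10 - ζ^3, ζ^4 - ζ^9, ζ^5 - ζ^8, ζ^2 - ζ^11, ζ^6 - ζ^7],
      ![ζ^10 - ζ^3, ζ^4 - ζ^9, ζ^12 - ζ, ζ^2 - ζ^11, ζ^6 - ζ^7, ζ^5 - ζ^8],
      ![ζ^4 - ζ^9, ζ^12 - ζ, ζ^10 - ζ^3, ζ^6 - ζ^7, ζ^5 - ζ^8, ζ^2 - ζ^11],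
      ![ζ^5 - ζ^8, ζ^2 - ζ^11, ζ^6 - ζ^7, ζ - ζ^12, ζ^3 - ζ^10, ζ^9 - ζ^4],
      ![ζ^2 - ζ^11, ζ^6 - ζ^7, ζ^5 - ζ^8, ζ^3 - ζ^10, ζ^9 - ζ^4, ζ - ζ^12],
      ![ζ^6 - ζ^7, ζ^5 - ζ^8, ζ^2 - ζ^11, ζ^9 - ζ^4, ζ - ζ^12, ζ^3 - ζ^10]]

/-- The matrix `H`, mapping `(z1,…,z6)` to `(z6, z4, z5, −z3, −z1, −z2)`. -/
def Hmat : Matrix (Fin 6) (Fin 6) ℂ :=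
  Matrix.of
    ![![0,0,0,0,0,1], ![0,0,0,1,0,0], ![0,0,0,0,1,0],
      ![0,0,-1,0,0,0], ![-1,0,0,0,0,0], ![0,-1,0,0,0,0]]

/-- The senary quadratic forms `A_0, …, A_6` (here `v 0 = z1, …, v 5 = z6`). -/
def A : ℕ → (Fin 6 → ℂ) → ℂ
  | 0, v => v 0 * v 3 + v 1 * v 4 + v 2 * v 5
  | 1, v => v 0 ^ 2 - 2 * v 2 * v 3
  | 2, v => -v 4 ^ 2 - 2 * v 1 * v 3
  | 3, v => v 1 ^ 2 - 2 * v 0 * v 4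
  | 4, v => v 2 ^ 2 - 2 * v 1 * v 5
  | 5, v => -v 3 ^ 2 - 2 * v 0 * v 5
  | 6, v => -v 5 ^ 2 - 2 * v 2 * v 4
  | _, _ => 0

/-- `w_ν = (A0 + ζ^ν A1 + ζ^{4ν} A2 + ζ^{9ν} A3 + ζ^{3ν} A4 + ζ^{12ν} A5 + ζ^{10ν} A6)^2`. -/
def w (ν : ℕ) (v : Fin 6 → ℂ) : ℂ :=
  (A 0 v + ζ ^ ν * A 1 v + ζ ^ (4 * ν) * A 2 v + ζ ^ (9 * ν) * A 3 v +
    ζ ^ (3 * ν) * A 4 v + ζ ^ (12 * ν) * A 5 v + ζ ^ (10 * ν) * A 6 v) ^ 2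

/-- `w_∞ = 13·A0^2`. -/
def winf (v : Fin 6 → ℂ) : ℂ := 13 * A 0 v ^ 2

/-- The senary cubic forms `D_0, …, D_12` (here `v 0 = z1, …, v 5 = z6`). -/
def D : ℕ → (Fin 6 → ℂ) → ℂ
  | 0, v => v 0 * v 1 * v 2
  | 1, v => 2 * v 1 * v 2 ^ 2 + v 1 ^ 2 * v 5 - v 3 ^ 2 * v 4 + v 0 * v 4 * v 5
  | 2, v => -v 5 ^ 3 + v 1 ^ 2 * v 3 - 2 * v 1 * v 4 ^ 2 + v 0 * v 3 * v 4 + 3 * v 2 * v 4 * v 5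
  | 3, v => 2 * v 0 * v 1 ^ 2 + v 0 ^ 2 * v 4 - v 3 * v 5 ^ 2 + v 2 * v 3 * v 4
  | 4, v => -v 1 ^ 2 * v 2 + v 0 * v 5 ^ 2 - 2 * v 3 ^ 2 * v 5 - v 0 * v 2 * v 4
  | 5, v => -v 3 ^ 3 + v 2 ^ 2 * v 4 - 2 * v 2 * v 5 ^ 2 + v 1 * v 4 * v 5 + 3 * v 0 * v 3 * v 5
  | 6, v => -v 4 ^ 3 + v 0 ^ 2 * v 5 - 2 * v 0 * v 3 ^ 2 + v 2 * v 3 * v 5 + 3 * v 1 * v 3 * v 4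
  | 7, v => -v 1 ^ 3 + v 2 * v 3 ^ 2 - v 0 * v 2 * v 5 - 3 * v 0 * v 1 * v 4 + 2 * v 0 ^ 2 * v 3
  | 8, v => -v 0 ^ 3 + v 1 * v 5 ^ 2 - v 1 * v 2 * v 4 - 3 * v 0 * v 2 * v 3 + 2 * v 2 ^ 2 * v 5
  | 9, v => 2 * v 0 ^ 2 * v 2 + v 2 ^ 2 * v 3 - v 4 ^ 2 * v 5 + v 1 * v 3 * v 5
  | 10, v => -v 0 * v 2 ^ 2 + v 1 * v 3 ^ 2 - 2 * v 3 * v 4 ^ 2 - v 0 * v 1 * v 5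
  | 11, v => -v 2 ^ 3 + v 0 * v 4 ^ 2 - v 0 * v 1 * v 3 - 3 * v 1 * v 2 * v 5 + 2 * v 1 ^ 2 * v 4
  | 12, v => -v 0 ^ 2 * v 1 + v 2 * v 4 ^ 2 - 2 * v 4 * v 5 ^ 2 - v 1 * v 2 * v 3
  | _, _ => 0

/-- The senary cubic form `D_∞ = z4 z5 z6`. -/
def Dinf (v : Fin 6 → ℂ) : ℂ := v 3 * v 4 * v 5

/-- The senary sextic forms `G_0, …, G_12`. -/
def Gs : ℕ → (Fin 6 → ℂ) → ℂ
  | 0, v => D 0 v ^ 2 + Dinf v ^ 2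
  | 1, v => -D 7 v ^ 2 + 2 * D 0 v * D 1 v + 10 * Dinf v * D 1 v + 2 * D 2 v * D 12 v
      - 2 * D 3 v * D 11 v - 4 * D 4 v * D 10 v - 2 * D 9 v * D 5 v
  | 2, v => -2 * D 1 v ^ 2 - 4 * D 0 v * D 2 v + 6 * Dinf v * D 2 v - 2 * D 4 v * D 11 v
      + 2 * D 5 v * D 10 v - 2 * D 6 v * D 9 v - 2 * D 7 v * D 8 v
  | 3, v => -D 8 v ^ 2 + 2 * D 0 v * D 3 v + 10 * Dinf v * D 3 v + 2 * D 6 v * D 10 v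
      - 2 * D 9 v * D 7 v - 4 * D 12 v * D 4 v - 2 * D 1 v * D 2 v
  | 4, v => -D 2 v ^ 2 + 10 * D 0 v * D 4 v - 2 * Dinf v * D 4 v + 2 * D 5 v * D 12 v
      - 2 * D 9 v * D 8 v - 4 * D 1 v * D 3 v - 2 * D 10 v * D 7 v
  | 5, v => -2 * D 9 v ^ 2 - 4 * D 0 v * D 5 v + 6 * Dinf v * D 5 v - 2 * D 10 v * D 8 v
      + 2 * D 6 v * D 12 v - 2 * D 2 v * D 3 v - 2 * D 11 v * D 7 v
  | 6, v => -2 * D 3 v ^ 2 - 4 * D 0 v * D 6 v + 6 * Dinf v * D 6 v - 2 * D 12 v * D 7 v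
      + 2 * D 2 v * D 4 v - 2 * D 5 v * D 1 v - 2 * D 8 v * D 11 v
  | 7, v => -2 * D 10 v ^ 2 + 6 * D 0 v * D 7 v + 4 * Dinf v * D 7 v - 2 * D 1 v * D 6 v
      - 2 * D 2 v * D 5 v - 2 * D 8 v * D 12 v - 2 * D 9 v * D 11 v
  | 8, v => -2 * D 4 v ^ 2 + 6 * D 0 v * D 8 v + 4 * Dinf v * D 8 v - 2 * D 3 v * D 5 v
      - 2 * D 6 v * D 2 v - 2 * D 11 v * D 10 v - 2 * D 1 v * D 7 v
  | 9, v => -D 11 v ^ 2 + 2 * D 0 v * D 9 v + 10 * Dinf v * D 9 v + 2 * D 5 v * D 4 v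
      - 2 * D 1 v * D 8 v - 4 * D 10 v * D 12 v - 2 * D 3 v * D 6 v
  | 10, v => -D 5 v ^ 2 + 10 * D 0 v * D 10 v - 2 * Dinf v * D 10 v + 2 * D 6 v * D 4 v
      - 2 * D 3 v * D 7 v - 4 * D 9 v * D 1 v - 2 * D 12 v * D 11 v
  | 11, v => -2 * D 12 v ^ 2 + 6 * D 0 v * D 11 v + 4 * Dinf v * D 11 v - 2 * D 9 v * D 2 v
      - 2 * D 5 v * D 6 v - 2 * D 7 v * D 4 v - 2 * D 3 v * D 8 v
  | 12, v => -D 6 v ^ 2 + 10 * D 0 v * D 12 v - 2 * Dinf v * D 12 v + 2 * D 2 v * D 10 v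
      - 2 * D 1 v * D 11 v - 4 * D 3 v * D 9 v - 2 * D 4 v * D 8 v
  | _, _ => 0

/-- `δ_ν = −13·G0 + Σ_{j=1}^{12} ζ^{jν} G_j`. -/
def deltaF (ν : ℕ) (v : Fin 6 → ℂ) : ℂ :=
  -13 * Gs 0 v + ∑ j ∈ Finset.Icc 1 12, ζ ^ (j * ν) * Gs j v

/-- `δ_∞ = 13^2·G0`. -/
def deltaInf (v : Fin 6 → ℂ) : ℂ := 13 ^ 2 * Gs 0 v

/-- `Φ4 = Σ_ν w_ν + w_∞`. -/
def Phi4 (v : Fin 6 → ℂ) : ℂ := (∑ ν ∈ Finset.range 13, w ν v) + winf v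

/-- `Φ8 = Σ_ν w_ν^2 + w_∞^2`. -/
def Phi8 (v : Fin 6 → ℂ) : ℂ := (∑ ν ∈ Finset.range 13, w ν v ^ 2) + winf v ^ 2

/-- `Φ12′ = −(1/(13·30))(Σ_ν w_ν^3 + w_∞^3)`. -/
def Phi12' (v : Fin 6 → ℂ) : ℂ :=
  -(1 / (13 * 30)) * ((∑ ν ∈ Finset.range 13, w ν v ^ 3) + winf v ^ 3)

/-- `Φ16 = Σ_ν w_ν^4 + w_∞^4`. -/
def Phi16 (v : Fin 6 → ℂ) : ℂ := (∑ ν ∈ Finset.range 13, w ν v ^ 4) + winf v ^ 4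

/-- `Φ20 = (1/(13·25))(Σ_ν w_ν^5 + w_∞^5)`. -/
def Phi20 (v : Fin 6 → ℂ) : ℂ :=
  (1 / (13 * 25)) * ((∑ ν ∈ Finset.range 13, w ν v ^ 5) + winf v ^ 5)

/-- `Φ12 = −(1/(13·52))(Σ_ν δ_ν^2 + δ_∞^2)`. -/
def Phi12 (v : Fin 6 → ℂ) : ℂ :=
  -(1 / (13 * 52)) * ((∑ ν ∈ Finset.range 13, deltaF ν v ^ 2) + deltaInf v ^ 2)

/-- `Φ18 = (1/(13·6))(Σ_ν δ_ν^3 + δ_∞^3)`. -/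
def Phi18 (v : Fin 6 → ℂ) : ℂ :=
  (1 / (13 * 6)) * ((∑ ν ∈ Finset.range 13, deltaF ν v ^ 3) + deltaInf v ^ 3)

/-- `Φ30 = −(1/(13·1315))(Σ_ν δ_ν^5 + δ_∞^5)`. -/
def Phi30 (v : Fin 6 → ℂ) : ℂ :=
  -(1 / (13 * 1315)) * ((∑ ν ∈ Finset.range 13, deltaF ν v ^ 5) + deltaInf v ^ 5)

/-- `q^α = exp(2πiαz)`. -/
def qp (α : ℚ) (z : ℂ) : ℂ := Complex.exp (2 * Real.pi * Complex.I * (α : ℂ) * z)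

/-- `Σ_{n∈ℤ} (−1)^n q^{(13n^2+cn)/2}`. -/
def thetaSum (c : ℤ) (z : ℂ) : ℂ :=
  ∑' n : ℤ, (-1 : ℂ) ^ n * qp ((13 * (n : ℚ) ^ 2 + (c : ℚ) * (n : ℚ)) / 2) z

/-- The theta constants of order 13: `a_1, …, a_6`. -/
def thc : ℕ → ℂ → ℂ
  | 1, z => qp (121 / 104) z * thetaSum 11 z
  | 2, z => qp (49 / 104) z * thetaSum 7 z
  | 3, z => qp (25 / 104) z * thetaSum 5 z
  | 4, z => -(qp (9 / 104) z * thetaSum 3 z)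
  | 5, z => qp (81 / 104) z * thetaSum 9 z
  | 6, z => qp (1 / 104) z * thetaSum 1 z
  | _, _ => 0

/-- The vector `A(z) = (a1(z), …, a6(z))`. -/
def Avec (z : ℂ) : Fin 6 → ℂ := fun i => thc (i.val + 1) z

/-- The Dedekind eta function `η(z) = q^{1/24} Π_{n=1}^∞ (1−q^n)`. -/
def etaF (z : ℂ) : ℂ :=
  qp (1 / 24) z * ∏' n : ℕ, (1 - Complex.exp (2 * Real.pi * Complex.I * z) ^ (n + 1))

/-- The vector `(x1(z), …, x6(z))` with `x_i(z) = η(z)·a_i(z)`. -/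
def X (z : ℂ) : Fin 6 → ℂ := fun i => etaF z * thc (i.val + 1) z

/-- The discriminant `Δ(z) = η(z)^24`. -/
def Delta (z : ℂ) : ℂ := etaF z ^ 24

/-- The Eisenstein series `E4(z) = (1/2) Σ_{gcd(m,n)=1} (mz+n)^{−4}`. -/
def E4 (z : ℂ) : ℂ :=
  (1 / 2) * ∑' p : {p : ℤ × ℤ // Int.gcd p.1 p.2 = 1},
    ((p.1.1 : ℂ) * z + (p.1.2 : ℂ)) ^ (-4 : ℤ)

/-- The Eisenstein series `E6(z) = (1/2) Σ_{gcd(m,n)=1} (mz+n)^{−6}`. -/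
def E6 (z : ℂ) : ℂ :=
  (1 / 2) * ∑' p : {p : ℤ × ℤ // Int.gcd p.1 p.2 = 1},
    ((p.1.1 : ℂ) * z + (p.1.2 : ℂ)) ^ (-6 : ℤ)

/-! ### The odd part of the Weil representation of `SL₂(𝔽₁₃)` -/

/-- The six coordinates of an odd function on `ℤ/13`. -/
def oddCoords (f : ZMod 13 → ℂ) : Fin 6 → ℂ := ![f 2, f 6, f 5, f 3, -f 4, f 1]

/-- The odd function on `ℤ/13` with given coordinates. -/
def oddExtension (v : Fin 6 → ℂ) : ZMod 13 → ℂ :=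
  (![0, v 5, v 0, v 3, -v 4, v 2, v 1, -v 1, -v 2, v 4, -v 3, -v 0, -v 5] : Fin 13 → ℂ)

/-- The Fourier transform on `ℤ/13`, with kernel `ζ^(-3kl)`. -/
def weilS (f : ZMod 13 → ℂ) (k : ZMod 13) : ℂ := ∑ l, ZMod.stdAddChar (-3 * k * l) * f l

/-- Multiplication by the quadratic character `ζ^(5νk²)`. -/
def weilT (ν : ZMod 13) (f : ZMod 13 → ℂ) (k : ZMod 13) : ℂ :=
  ZMod.stdAddChar (5 * ν * k ^ 2) * f k

lemma stdAddChar_eq_zeta13_pow (a : ZMod 13) : ZMod.stdAddChar a = ζ ^ a.val := by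
  rw [ZMod.stdAddChar_apply, ZMod.toCircle_apply, zeta13, ← Complex.exp_nat_mul]
  congr 1
  push_cast
  ring

lemma zeta13_isPrimitiveRoot : IsPrimitiveRoot ζ 13 := by
  simpa [zeta13] using Complex.isPrimitiveRoot_exp 13 (by norm_num)

lemma zeta13_pow_thirteen : ζ ^ 13 = 1 := zeta13_isPrimitiveRoot.pow_eq_one

lemma IsPrimitiveRoot.sum_pow_thirteen {x : ℂ} (hx : IsPrimitiveRoot x 13) :
    1 + x + x ^ 2 + x ^ 3 + x ^ 4 + x ^ 5 + x ^ 6 + x ^ 7 + x ^ 8 + x ^ 9 + x ^ 10 + x ^ 11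
      + x ^ 12 = 0 := by
  have h := hx.geom_sum_eq_zero (by norm_num)
  simpa [Finset.sum_range_succ] using h

lemma oddCoords_oddExtension (v : Fin 6 → ℂ) : oddCoords (oddExtension v) = v := by
  ext i
  fin_cases i
  · rfl
  · rfl
  · rfl
  · rfl
  · exact neg_neg _
  · rfl

lemma oddExtension_neg (v : Fin 6 → ℂ) (k : ZMod 13) :
    oddExtension v (-k) = -oddExtension v k := by
  fin_cases k
  · exact (neg_zero).symm
  all_goals first | rfl | exact (neg_neg _).symm

lemma oddExtension_oddCoords {f : ZMod 13 → ℂ} (hf : ∀ k, f (-k) = -f k) :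
    oddExtension (oddCoords f) = f := by
  have h0 : f 0 = 0 := by
    have := hf 0
    rw [neg_zero] at this
    linear_combination this / 2
  ext k
  fin_cases k
  · exact h0.symm
  · rfl
  · rfl
  · rfl
  · exact neg_neg _
  · rfl
  · rfl
  · exact (hf 6).symm
  · exact (hf 5).symm
  · exact (hf 4).symm
  · exact (hf 3).symm
  · exact (hf 2).symm
  · exact (hf 1).symm

lemma weilS_neg {f : ZMod 13 → ℂ} (hf : ∀ k, f (-k) = -f k) (k : ZMod 13) :
    weilS f (-k) = -weilS f k := by
  unfold weilS
  rw [← Equiv.sum_comp (Equiv.neg (ZMod 13)), ← Finset.sum_neg_distrib]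
  refine Finset.sum_congr rfl fun l _ ↦ ?_
  simp only [Equiv.neg_apply, hf]
  rw [show -3 * -k * -l = -3 * k * l by ring]
  ring

lemma weilT_neg {f : ZMod 13 → ℂ} (hf : ∀ k, f (-k) = -f k) (ν k : ZMod 13) :
    weilT ν f (-k) = -weilT ν f k := by
  simp [weilT, hf]

instance : Fact (Nat.Prime 13) := ⟨by norm_num⟩

/-- The quadratic Gauss sum `∑ ζ^(aℓ²)`. -/
def quadGauss (a : ZMod 13) : ℂ := ∑ l : ZMod 13, ZMod.stdAddChar (a * l ^ 2)

lemma quadGauss_sq {a : ZMod 13} (ha : a ≠ 0) : quadGauss a ^ 2 = 13 := by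
  have hp : IsPrimitiveRoot (ζ ^ a.val) 13 := by
    refine zeta13_isPrimitiveRoot.pow_of_coprime _ ?_
    refine (Nat.Coprime.symm ((Nat.Prime.coprime_iff_not_dvd (by norm_num)).2 fun h ↦ ha ?_))
    exact (ZMod.val_eq_zero a).1 (Nat.eq_zero_of_dvd_of_lt h (ZMod.val_lt a))
  have h13 := hp.pow_eq_one
  have hs := hp.sum_pow_thirteen
  have key (n : ℕ) : ZMod.stdAddChar (a * (n : ZMod 13)) = (ζ ^ a.val) ^ n := by
    rw [mul_comm, ← nsmul_eq_mul, AddChar.map_nsmul_eq_pow, stdAddChar_eq_zeta13_pow]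
  have hg : quadGauss a = 1 + 2 * ((ζ ^ a.val) ^ 1 + (ζ ^ a.val) ^ 4 + (ζ ^ a.val) ^ 9
      + (ζ ^ a.val) ^ 3 + (ζ ^ a.val) ^ 12 + (ζ ^ a.val) ^ 10) := by
    simp only [← key]
    have (F : ZMod 13 → ℂ) : ∑ l, F l = ∑ l : Fin 13, F l := rfl
    rw [quadGauss, this]
    simp only [Fin.sum_univ_succ, Fin.sum_univ_zero]
    change ZMod.stdAddChar (a * (0 : ZMod 13)) + (ZMod.stdAddChar (a * (1 : ZMod 13)) + (ZMod.stdAddChar (a * (4 : ZMod 13)) +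
      (ZMod.stdAddChar (a * (9 : ZMod 13)) + (ZMod.stdAddChar (a * (3 : ZMod 13)) + (ZMod.stdAddChar (a * (12 : ZMod 13)) +
      (ZMod.stdAddChar (a * (10 : ZMod 13)) + (ZMod.stdAddChar (a * (10 : ZMod 13)) + (ZMod.stdAddChar (a * (12 : ZMod 13)) +
      (ZMod.stdAddChar (a * (3 : ZMod 13)) + (ZMod.stdAddChar (a * (9 : ZMod 13)) + (ZMod.stdAddChar (a * (4 : ZMod 13)) +
      (ZMod.stdAddChar (a * (1 : ZMod 13)) + 0)))))))))))) = _
    simp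
    ring
  rw [hg]
  generalize ζ ^ a.val = x at *
  grind

/-- Completing the square in the double Fourier transform. -/
lemma weilS_weilT_weilS (f : ZMod 13 → ℂ) {ν : ZMod 13} (hν : ν ≠ 0) :
    weilS (weilT ν (weilS f)) = quadGauss (5 * ν) •
      weilT (-ν⁻¹) (fun k ↦ weilS (weilT (-ν⁻¹) f) (-ν⁻¹ * k)) := by
  ext k
  simp only [weilS, weilT, Pi.smul_apply, smul_eq_mul, Finset.mul_sum]
  rw [Finset.sum_comm]
  refine Finset.sum_congr rfl fun m _ ↦ ?_
  rw [quadGauss, ← Equiv.sum_comp (Equiv.addRight (-((k + m) * ν⁻¹))), Finset.sum_mul]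
  refine Finset.sum_congr rfl fun l _ ↦ ?_
  simp only [Equiv.coe_addRight, ← mul_assoc, ← AddChar.map_add_eq_mul]
  congr 2
  have h13 : (13 : ZMod 13) = 0 := rfl
  have hinv : ν * ν⁻¹ = 1 := mul_inv_cancel₀ hν
  linear_combination (-10 * l * (k + m) + 5 * (k + m) ^ 2 * ν⁻¹) * hinv +
    (-l * (k + m) + (k ^ 2 + m ^ 2 + k * m) * ν⁻¹) * h13

lemma weilS_weilS (f : ZMod 13 → ℂ) : weilS (weilS f) = fun k ↦ 13 * f (-k) := by
  ext k
  simp only [weilS, Finset.mul_sum]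
  rw [Finset.sum_comm]
  have (m : ZMod 13) : ∑ l, ZMod.stdAddChar (-3 * k * l) * (ZMod.stdAddChar (-3 * l * m) * f m) =
      if m = -k then 13 * f m else 0 := by
    have h := AddChar.sum_mulShift (R := ZMod 13) (-3 * (k + m))
      (ZMod.isPrimitive_stdAddChar 13)
    have h3 : (-3 * (k + m) = 0) ↔ m = -k := by
      rw [mul_eq_zero, eq_neg_iff_add_eq_zero, add_comm m]
      exact or_iff_right (by decide)
    simp only [h3] at h
    simp only [← mul_assoc, ← AddChar.map_add_eq_mul, ← Finset.sum_mul]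
    rw [show ∑ l, ZMod.stdAddChar (-3 * k * l + -3 * l * m) =
      ∑ l, ZMod.stdAddChar (l * (-3 * (k + m))) from Finset.sum_congr rfl fun l _ ↦ by ring_nf, h]
    split_ifs <;> simp
  simp only [this, Finset.sum_ite_eq', Finset.mem_univ, if_true]

/-- Summing a homogeneous Borel-invariant function over the cosets of the Borel subgroup gives a
function which is invariant, up to a power of `13`, under the Fourier transform. -/
lemma sum_weilS_weilT_invariant {Q : (ZMod 13 → ℂ) → ℂ} {e : ℕ} (n : ℕ)
    (hsmul : ∀ (c : ℂ) f, Q (c • f) = c ^ (2 * (e + 1)) * Q f)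
    (hT : ∀ ν f, Q (weilT ν f) = Q f)
    (hmul : ∀ (c : ZMod 13) f, c ≠ 0 → (∀ k, f (-k) = -f k) → Q (fun k ↦ f (c * k)) = Q f)
    {f : ZMod 13 → ℂ} (hf : ∀ k, f (-k) = -f k) :
    (∑ ν, (Q (weilS (weilT ν (weilS f))) / 13) ^ n) + (13 ^ e * Q (weilS f)) ^ n =
      13 ^ ((e + 1) * n) * ((∑ ν, (Q (weilS (weilT ν f)) / 13) ^ n) + (13 ^ e * Q f) ^ n) := by
  have hT0 (g : ZMod 13 → ℂ) : weilT 0 g = g := by ext; simp [weilT]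
  have h0 : Q (weilS (weilT 0 (weilS f))) = 13 ^ (2 * (e + 1)) * Q f := by
    rw [hT0, weilS_weilS, ← hsmul, ← hmul (-1) ((13 : ℂ) • f) (by decide) (by simp [hf])]
    simp [hf]
  have hne (ν : ZMod 13) (hν : ν ≠ 0) :
      Q (weilS (weilT ν (weilS f))) = 13 ^ (e + 1) * Q (weilS (weilT (-ν⁻¹) f)) := by
    rw [weilS_weilT_weilS f hν, hsmul, hT, pow_mul,
      quadGauss_sq (mul_ne_zero (by decide) hν), hmul _ _ (by simpa using hν)
      (weilS_neg (weilT_neg hf _))]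
  rw [Fintype.sum_eq_add_sum_compl 0, Fintype.sum_eq_add_sum_compl (0 : ZMod 13), h0, hT0]
  have hsum : ∑ ν ∈ ({0}ᶜ : Finset (ZMod 13)), (Q (weilS (weilT ν (weilS f))) / 13) ^ n =
      13 ^ ((e + 1) * n) *
        ∑ ν ∈ ({0}ᶜ : Finset (ZMod 13)), (Q (weilS (weilT ν f)) / 13) ^ n := by
    rw [Finset.mul_sum]
    refine Finset.sum_bij' (fun ν _ ↦ -ν⁻¹) (fun ν _ ↦ -ν⁻¹) (by simp) (by simp)
      (by simp [inv_neg]) (by simp [inv_neg]) fun ν hν ↦ ?_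
    rw [hne ν (by simpa using hν), pow_mul, ← mul_pow]
    ring
  rw [hsum]
  have e1 : (13 ^ (2 * (e + 1)) * Q f / 13) ^ n =
      13 ^ ((e + 1) * n) * (13 ^ e * Q f) ^ n := by
    rw [pow_mul (13 : ℂ) (e + 1), ← mul_pow]
    ring
  have e2 : (13 ^ e * Q (weilS f)) ^ n = 13 ^ ((e + 1) * n) * (Q (weilS f) / 13) ^ n := by
    rw [pow_mul (13 : ℂ) (e + 1), ← mul_pow]
    ring
  rw [e1, e2]
  ring

lemma sum_weilS_weilT_weilT {Q : (ZMod 13 → ℂ) → ℂ} (g : ℂ → ℂ) (μ : ZMod 13)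
    (f : ZMod 13 → ℂ) :
    ∑ ν, g (Q (weilS (weilT ν (weilT μ f)))) = ∑ ν, g (Q (weilS (weilT ν f))) := by
  rw [← Equiv.sum_comp (Equiv.addRight μ) fun ν ↦ g (Q (weilS (weilT ν f)))]
  refine Finset.sum_congr rfl fun ν _ ↦ ?_
  congr 3
  ext k
  simp only [weilT, Equiv.coe_addRight, ← mul_assoc, ← AddChar.map_add_eq_mul]
  ring_nf

/-- The discrete sine transform with values `s₁, …, s₆`. -/
def sineTransform (s1 s2 s3 s4 s5 s6 : ℂ) (v : Fin 6 → ℂ) : Fin 6 → ℂ :=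
  ![s1 * v 0 - s2 * v 4 + s3 * v 1 - s4 * v 2 - s5 * v 3 - s6 * v 5,
    s1 * v 2 - s2 * v 3 + s3 * v 0 - s4 * v 1 - s5 * v 5 - s6 * v 4,
    s1 * v 1 - s2 * v 5 + s3 * v 2 - s4 * v 0 - s5 * v 4 - s6 * v 3,
    -s1 * v 3 - s2 * v 1 - s3 * v 4 + s4 * v 5 - s5 * v 0 - s6 * v 2,
    -s1 * v 5 - s2 * v 0 - s3 * v 3 + s4 * v 4 - s5 * v 2 - s6 * v 1,
    -s1 * v 4 - s2 * v 2 - s3 * v 5 + s4 * v 3 - s5 * v 1 - s6 * v 0]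

/-- The Fourier transform in coordinates. -/
def fourierVec (x : ℂ) (v : Fin 6 → ℂ) : Fin 6 → ℂ :=
  sineTransform (x - x ^ 12) (x ^ 2 - x ^ 11) (x ^ 3 - x ^ 10) (x ^ 4 - x ^ 9) (x ^ 5 - x ^ 8)
    (x ^ 6 - x ^ 7) v

lemma oddCoords_weilS (v : Fin 6 → ℂ) :
    oddCoords (weilS (oddExtension v)) = fourierVec ζ v := by
  have hs (F : ZMod 13 → ℂ) : ∑ l, F l = ∑ l : Fin 13, F l := rfl
  have hsum (k : ZMod 13) : weilS (oddExtension v) k =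
      (ζ ^ (-3 * k).val - ζ ^ (3 * k).val) * v 5 + (ζ ^ (-6 * k).val - ζ ^ (6 * k).val) * v 0
      + (ζ ^ (-9 * k).val - ζ ^ (9 * k).val) * v 3 - (ζ ^ (-12 * k).val - ζ ^ (12 * k).val) * v 4
      + (ζ ^ (-15 * k).val - ζ ^ (15 * k).val) * v 2
      + (ζ ^ (-18 * k).val - ζ ^ (18 * k).val) * v 1 := by
    simp only [← stdAddChar_eq_zeta13_pow]
    rw [weilS, hs]
    simp only [Fin.sum_univ_succ, Fin.sum_univ_zero]
    change ZMod.stdAddChar (-3 * k * (0 : ZMod 13)) * 0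
      + (ZMod.stdAddChar (-3 * k * (1 : ZMod 13)) * v 5
      + (ZMod.stdAddChar (-3 * k * (2 : ZMod 13)) * v 0
      + (ZMod.stdAddChar (-3 * k * (3 : ZMod 13)) * v 3
      + (ZMod.stdAddChar (-3 * k * (4 : ZMod 13)) * -v 4
      + (ZMod.stdAddChar (-3 * k * (5 : ZMod 13)) * v 2
      + (ZMod.stdAddChar (-3 * k * (6 : ZMod 13)) * v 1
      + (ZMod.stdAddChar (-3 * k * (-6 : ZMod 13)) * -v 1
      + (ZMod.stdAddChar (-3 * k * (-5 : ZMod 13)) * -v 2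
      + (ZMod.stdAddChar (-3 * k * (-4 : ZMod 13)) * v 4
      + (ZMod.stdAddChar (-3 * k * (-3 : ZMod 13)) * -v 3
      + (ZMod.stdAddChar (-3 * k * (-2 : ZMod 13)) * -v 0
      + (ZMod.stdAddChar (-3 * k * (-1 : ZMod 13)) * -v 5 + 0)))))))))))) = _
    ring_nf
  simp only [fourierVec, sineTransform]
  ext i
  fin_cases i
  · refine (hsum 2).trans ?_
    change (ζ ^ 7 - ζ ^ 6) * v 5 + (ζ ^ 1 - ζ ^ 12) * v 0 + (ζ ^ 8 - ζ ^ 5) * v 3 - (ζ ^ 2 - ζ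
      ^ 11) * v 4 + (ζ ^ 9 - ζ ^ 4) * v 2 + (ζ ^ 3 - ζ ^ 10) * v 1 = _
    simp only [Fin.mk_zero, Matrix.cons_val]
    ring
  · refine (hsum 6).trans ?_
    change (ζ ^ 8 - ζ ^ 5) * v 5 + (ζ ^ 3 - ζ ^ 10) * v 0 + (ζ ^ 11 - ζ ^ 2) * v 3 - (ζ ^ 6 -
      ζ ^ 7) * v 4 + (ζ ^ 1 - ζ ^ 12) * v 2 + (ζ ^ 9 - ζ ^ 4) * v 1 = _
    simp only [Fin.mk_one, Matrix.cons_val]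
    ring
  · refine (hsum 5).trans ?_
    change (ζ ^ 11 - ζ ^ 2) * v 5 + (ζ ^ 9 - ζ ^ 4) * v 0 + (ζ ^ 7 - ζ ^ 6) * v 3 - (ζ ^ 5 - ζ
      ^ 8) * v 4 + (ζ ^ 3 - ζ ^ 10) * v 2 + (ζ ^ 1 - ζ ^ 12) * v 1 = _
    simp only [Fin.reduceFinMk, Matrix.cons_val]
    ring
  · refine (hsum 3).trans ?_
    change (ζ ^ 4 - ζ ^ 9) * v 5 + (ζ ^ 8 - ζ ^ 5) * v 0 + (ζ ^ 12 - ζ ^ 1) * v 3 - (ζ ^ 3 - ζ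
      ^ 10) * v 4 + (ζ ^ 7 - ζ ^ 6) * v 2 + (ζ ^ 11 - ζ ^ 2) * v 1 = _
    simp only [Fin.reduceFinMk, Matrix.cons_val]
    ring
  · refine (congrArg Neg.neg (hsum 4)).trans ?_
    change -((ζ ^ 1 - ζ ^ 12) * v 5 + (ζ ^ 2 - ζ ^ 11) * v 0 + (ζ ^ 3 - ζ ^ 10) * v 3 - (ζ ^ 4
      - ζ ^ 9) * v 4 + (ζ ^ 5 - ζ ^ 8) * v 2 + (ζ ^ 6 - ζ ^ 7) * v 1) = _
    simp only [Fin.reduceFinMk, Matrix.cons_val]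
    ring
  · refine (hsum 1).trans ?_
    change (ζ ^ 10 - ζ ^ 3) * v 5 + (ζ ^ 7 - ζ ^ 6) * v 0 + (ζ ^ 4 - ζ ^ 9) * v 3 - (ζ ^ 1 - ζ
      ^ 12) * v 4 + (ζ ^ 11 - ζ ^ 2) * v 2 + (ζ ^ 8 - ζ ^ 5) * v 1 = _
    simp only [Fin.reduceFinMk, Matrix.cons_val]
    ring

lemma A_zero_fourierVec {x : ℂ}
    (h : 1 + x + x ^ 2 + x ^ 3 + x ^ 4 + x ^ 5 + x ^ 6 + x ^ 7 + x ^ 8 + x ^ 9 + x ^ 10 + x ^ 11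
      + x ^ 12 = 0) (v : Fin 6 → ℂ) :
    A 0 (fourierVec x v) ^ 2 =
      13 * (A 0 v + A 1 v + A 2 v + A 3 v + A 4 v + A 5 v + A 6 v) ^ 2 := by
  have hA : A 0 (fourierVec x v) = (-1 - 2 * x ^ 2 - 2 * x ^ 5 - 2 * x ^ 6 - 2 * x ^ 7 - 2 * x ^ 8 - 2 * x ^ 11) *
      (A 0 v + A 1 v + A 2 v + A 3 v + A 4 v + A 5 v + A 6 v) := by
    simp only [A, fourierVec, sineTransform, Matrix.cons_val]
    linear_combination ((v 0 ^ 2 + v 1 ^ 2 + v 2 ^ 2 - v 3 ^ 2 - v 4 ^ 2 - v 5 ^ 2) * (1 - x + 2 * x ^ 2 - 2 * x ^ 3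
      + x ^ 5 + x ^ 7 - x ^ 9) + (v 0 * v 1 + v 0 * v 2 + v 1 * v 2 - v 3 * v 4 - v 3 * v 5 - v 4
      * v 5) * (-x ^ 3 + x ^ 4 + x ^ 6 - 2 * x ^ 7 + x ^ 8 + x ^ 10 - x ^ 11) + (v 0 * v 3 + v 1 *
      v 4 + v 2 * v 5) * (1 - x + x ^ 2 - x ^ 3 + x ^ 4 + x ^ 5 - x ^ 6 + x ^ 7 - x ^ 8 - x ^ 9 +
      x ^ 10 + x ^ 11 - x ^ 12) + (v 0 * v 4 + v 0 * v 5 + v 1 * v 3 + v 1 * v 5 + v 2 * v 3 + v 2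
      * v 4) * (-2 + 2 * x - 4 * x ^ 2 + 4 * x ^ 3 - x ^ 4 - 2 * x ^ 5 - x ^ 6 + 2 * x ^ 7 - x ^ 8
      + 2 * x ^ 9 - x ^ 10)) * h
  have hk : (-1 - 2 * x ^ 2 - 2 * x ^ 5 - 2 * x ^ 6 - 2 * x ^ 7 - 2 * x ^ 8 - 2 * x ^ 11) ^ 2 = 13 := by
    linear_combination (-12 + 12 * x + 4 * x ^ 2 - 4 * x ^ 3 + 4 * x ^ 4 + 8 * x ^ 7 - 4 * x ^ 9 + 4 * x ^ 10) * h
  rw [hA, mul_pow, hk]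

lemma D_sineTransform {s1 s2 s3 s4 s5 s6 a b α α' γ γ' : ℂ}
    (h1 : -s1 * s3 * s4 = γ')
    (h2 : s1 ^ 2 * s3 + s1 * s4 ^ 2 - s3 ^ 2 * s4 = α')
    (h3 : -s1 ^ 2 * s4 + s1 * s3 ^ 2 + s3 * s4 ^ 2 = 2 * α)
    (h4 : s1 * s2 * s4 - s1 * s3 * s6 + s3 * s4 * s5 = -2 * γ')
    (h5 : -s1 * s3 * s5 + s1 * s4 * s6 + s2 * s3 * s4 = α)
    (h6 : -s1 * s2 * s3 + s1 * s4 * s5 + s3 * s4 * s6 = γ)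
    (h7 : s1 ^ 3 - 3 * s1 * s3 * s4 + s3 ^ 3 - s4 ^ 3 = a)
    (h8 : -s1 ^ 2 * s2 - s1 * s3 * s5 + s1 * s4 * s6 + s2 * s3 * s4 - s3 ^ 2 * s6 - s4 ^ 2 * s5 = γ')
    (h9 : -s1 ^ 2 * s6 - s1 * s2 * s3 + s1 * s4 * s5 - s2 * s4 ^ 2 - s3 ^ 2 * s5 + s3 * s4 * s6 = 3 * γ')
    (h10 : -s1 ^ 2 * s5 + s1 * s2 * s4 - s1 * s3 * s6 - s2 * s3 ^ 2 + s3 * s4 * s5 - s4 ^ 2 * s6 = α')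
    (h11 : s1 * s2 * s6 - s2 * s4 * s5 + s3 * s5 * s6 = -2 * γ)
    (h12 : s1 * s2 * s5 + s1 * s6 ^ 2 - s2 ^ 2 * s4 + s2 * s3 * s6 + s3 * s5 ^ 2 - s4 * s5 * s6 = γ)
    (h13 : s1 * s2 ^ 2 + s1 * s5 * s6 + s2 * s3 * s5 - s2 * s4 * s6 + s3 * s6 ^ 2 - s4 * s5 ^ 2 = 3 * γ)
    (h14 : s1 * s5 * s6 + s2 * s3 * s5 - s2 * s4 * s6 = -γ')
    (h15 : s1 * s2 * s6 + s1 * s5 ^ 2 + s2 ^ 2 * s3 - s2 * s4 * s5 + s3 * s5 * s6 - s4 * s6 ^ 2 = α)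
    (h16 : s1 * s2 * s5 + s2 * s3 * s6 - s4 * s5 * s6 = -α')
    (h17 : -s2 * s5 * s6 = -γ)
    (h18 : -s2 ^ 2 * s6 - s2 * s5 ^ 2 - s5 * s6 ^ 2 = -α)
    (h19 : -s2 ^ 2 * s5 - s2 * s6 ^ 2 - s5 ^ 2 * s6 = 2 * α')
    (h20 : -s2 ^ 3 - 3 * s2 * s5 * s6 - s5 ^ 3 - s6 ^ 3 = b)
    (v : Fin 6 → ℂ) :
    D 0 (sineTransform s1 s2 s3 s4 s5 s6 v) = a * D 0 v + b * Dinf v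
        + α * (D 1 v + D 3 v + D 9 v) - α' * (D 4 v + D 10 v + D 12 v)
        + γ * (D 2 v + D 5 v + D 6 v) - γ' * (D 7 v + D 8 v + D 11 v) ∧
    Dinf (sineTransform s1 s2 s3 s4 s5 s6 v) = b * D 0 v - a * Dinf v
        + α' * (D 1 v + D 3 v + D 9 v) + α * (D 4 v + D 10 v + D 12 v)
        + γ' * (D 2 v + D 5 v + D 6 v) + γ * (D 7 v + D 8 v + D 11 v) := by
  simp only [D, Dinf, sineTransform, Matrix.cons_val]
  constructor
  · linear_combination (v 0 ^ 3 + v 1 ^ 3 + v 2 ^ 3) * h1 + (v 0 ^ 2 * v 1 + v 0 * v 2 ^ 2 + v 1 ^ 2 * v 2) * h2 +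
      (v 0 ^ 2 * v 2 + v 0 * v 1 ^ 2 + v 1 * v 2 ^ 2) * h3 + (v 0 ^ 2 * v 3 + v 1 ^ 2 * v 4 + v 2
      ^ 2 * v 5) * h4 + (v 0 ^ 2 * v 4 + v 1 ^ 2 * v 5 + v 2 ^ 2 * v 3) * h5 + (v 0 ^ 2 * v 5 + v
      1 ^ 2 * v 3 + v 2 ^ 2 * v 4) * h6 + (v 0 * v 1 * v 2) * h7 + (v 0 * v 1 * v 3 + v 0 * v 2 *
      v 5 + v 1 * v 2 * v 4) * h8 + (v 0 * v 1 * v 4 + v 0 * v 2 * v 3 + v 1 * v 2 * v 5) * h9 +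
      (v 0 * v 1 * v 5 + v 0 * v 2 * v 4 + v 1 * v 2 * v 3) * h10 + (v 0 * v 3 ^ 2 + v 1 * v 4 ^ 2
      + v 2 * v 5 ^ 2) * h11 + (v 0 * v 3 * v 4 + v 1 * v 4 * v 5 + v 2 * v 3 * v 5) * h12 + (v 0
      * v 3 * v 5 + v 1 * v 3 * v 4 + v 2 * v 4 * v 5) * h13 + (v 0 * v 4 ^ 2 + v 1 * v 5 ^ 2 + v
      2 * v 3 ^ 2) * h14 + (v 0 * v 4 * v 5 + v 1 * v 3 * v 5 + v 2 * v 3 * v 4) * h15 + (v 0 * v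
      5 ^ 2 + v 1 * v 3 ^ 2 + v 2 * v 4 ^ 2) * h16 + (v 3 ^ 3 + v 4 ^ 3 + v 5 ^ 3) * h17 + (v 3 ^
      2 * v 4 + v 3 * v 5 ^ 2 + v 4 ^ 2 * v 5) * h18 + (v 3 ^ 2 * v 5 + v 3 * v 4 ^ 2 + v 4 * v 5
      ^ 2) * h19 + (v 3 * v 4 * v 5) * h20
  · linear_combination (-v 3 ^ 3 - v 4 ^ 3 - v 5 ^ 3) * h1 + (-v 3 ^ 2 * v 4 - v 3 * v 5 ^ 2 - v 4 ^ 2 * v 5) * h2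
      + (-v 3 ^ 2 * v 5 - v 3 * v 4 ^ 2 - v 4 * v 5 ^ 2) * h3 + (v 0 * v 3 ^ 2 + v 1 * v 4 ^ 2 + v
      2 * v 5 ^ 2) * h4 + (v 0 * v 5 ^ 2 + v 1 * v 3 ^ 2 + v 2 * v 4 ^ 2) * h5 + (v 0 * v 4 ^ 2 +
      v 1 * v 5 ^ 2 + v 2 * v 3 ^ 2) * h6 + (-v 3 * v 4 * v 5) * h7 + (v 0 * v 3 * v 4 + v 1 * v 4
      * v 5 + v 2 * v 3 * v 5) * h8 + (v 0 * v 3 * v 5 + v 1 * v 3 * v 4 + v 2 * v 4 * v 5) * h9 +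
      (v 0 * v 4 * v 5 + v 1 * v 3 * v 5 + v 2 * v 3 * v 4) * h10 + (-v 0 ^ 2 * v 3 - v 1 ^ 2 * v
      4 - v 2 ^ 2 * v 5) * h11 + (-v 0 * v 1 * v 3 - v 0 * v 2 * v 5 - v 1 * v 2 * v 4) * h12 +
      (-v 0 * v 1 * v 4 - v 0 * v 2 * v 3 - v 1 * v 2 * v 5) * h13 + (-v 0 ^ 2 * v 5 - v 1 ^ 2 * v
      3 - v 2 ^ 2 * v 4) * h14 + (-v 0 * v 1 * v 5 - v 0 * v 2 * v 4 - v 1 * v 2 * v 3) * h15 +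
      (-v 0 ^ 2 * v 4 - v 1 ^ 2 * v 5 - v 2 ^ 2 * v 3) * h16 + (v 0 ^ 3 + v 1 ^ 3 + v 2 ^ 3) * h17
      + (v 0 ^ 2 * v 1 + v 0 * v 2 ^ 2 + v 1 ^ 2 * v 2) * h18 + (v 0 ^ 2 * v 2 + v 0 * v 1 ^ 2 + v
      1 * v 2 ^ 2) * h19 + (v 0 * v 1 * v 2) * h20

lemma D_fourierVec {x : ℂ}
    (h : 1 + x + x ^ 2 + x ^ 3 + x ^ 4 + x ^ 5 + x ^ 6 + x ^ 7 + x ^ 8 + x ^ 9 + x ^ 10 + x ^ 11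
      + x ^ 12 = 0) :
    ∃ a b α α' γ γ' : ℂ, a ^ 2 + b ^ 2 = -169 ∧ α ^ 2 + α' ^ 2 = -26 ∧
      γ ^ 2 + γ' ^ 2 = -13 ∧ α * γ + α' * γ' = -13 ∧ α * γ' - α' * γ = 13 ∧
      a * α + b * α' = 13 ∧ b * α - a * α' = 65 ∧ a * γ + b * γ' = -26 ∧ b * γ - a * γ' = 39 ∧
      ∀ v, D 0 (fourierVec x v) = a * D 0 v + b * Dinf v + α * (D 1 v + D 3 v + D 9 v)
        - α' * (D 4 v + D 10 v + D 12 v) + γ * (D 2 v + D 5 v + D 6 v)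
        - γ' * (D 7 v + D 8 v + D 11 v) ∧
      Dinf (fourierVec x v) = b * D 0 v - a * Dinf v + α' * (D 1 v + D 3 v + D 9 v)
        + α * (D 4 v + D 10 v + D 12 v) + γ' * (D 2 v + D 5 v + D 6 v)
        + γ * (D 7 v + D 8 v + D 11 v) := by
  refine ⟨-2 - 4 * x + x ^ 2 - 4 * x ^ 3 + x ^ 5 + x ^ 6 - 5 * x ^ 7 - 5 * x ^ 8 - 4 * x ^ 9 - 5 * x ^ 11,
    3 + 6 * x + 5 * x ^ 2 + 6 * x ^ 3 + 5 * x ^ 5 + 5 * x ^ 6 + x ^ 7 + x ^ 8 + 6 * x ^ 9 + x ^ 11,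
    -1 - 2 * x - 2 * x ^ 2 - 2 * x ^ 3 - 2 * x ^ 5 - 2 * x ^ 6 - 2 * x ^ 9, -1 - 2 * x - 2 * x ^ 3 - 2 * x ^ 7 - 2 * x ^ 8 - 2 * x ^ 9 - 2 * x ^ 11,
    -1 - 2 * x - x ^ 2 - 2 * x ^ 3 - x ^ 5 - x ^ 6 - x ^ 7 - x ^ 8 - 2 * x ^ 9 - x ^ 11,
    x ^ 2 + x ^ 5 + x ^ 6 - x ^ 7 - x ^ 8 - x ^ 11, ?_, ?_, ?_, ?_, ?_, ?_, ?_, ?_, ?_, fun v ↦ D_sineTransform ?_ ?_ ?_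
      ?_ ?_ ?_ ?_ ?_ ?_ ?_ ?_ ?_ ?_ ?_ ?_ ?_ ?_ ?_ ?_ ?_ v⟩
  · linear_combination (182 - 130 * x + 26 * x ^ 2 + 26 * x ^ 3 + 26 * x ^ 4 - 52 * x ^ 5 + 52 * x ^ 6 + 52 * x ^ 8
      - 26 * x ^ 9 + 26 * x ^ 10) * h
  · linear_combination (28 - 20 * x + 4 * x ^ 2 + 4 * x ^ 3 + 4 * x ^ 4 - 8 * x ^ 5 + 8 * x ^ 6 + 8 * x ^ 8 - 4 * x
      ^ 9 + 4 * x ^ 10) * h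
  · linear_combination (14 - 10 * x + 2 * x ^ 2 + 2 * x ^ 3 + 2 * x ^ 4 - 4 * x ^ 5 + 4 * x ^ 6 + 4 * x ^ 8 - 2 * x
      ^ 9 + 2 * x ^ 10) * h
  · linear_combination (14 - 10 * x + 2 * x ^ 2 + 2 * x ^ 3 + 2 * x ^ 4 - 4 * x ^ 5 + 4 * x ^ 6 + 4 * x ^ 8 - 2 * x
      ^ 9 + 2 * x ^ 10) * h
  · linear_combination (-14 + 10 * x - 2 * x ^ 2 - 2 * x ^ 3 - 2 * x ^ 4 + 4 * x ^ 5 - 4 * x ^ 6 - 4 * x ^ 8 + 2 * x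
      ^ 9 - 2 * x ^ 10) * h
  · linear_combination (-14 + 10 * x - 2 * x ^ 2 - 2 * x ^ 3 - 2 * x ^ 4 + 4 * x ^ 5 - 4 * x ^ 6 - 4 * x ^ 8 + 2 * x
      ^ 9 - 2 * x ^ 10) * h
  · linear_combination (-70 + 50 * x - 10 * x ^ 2 - 10 * x ^ 3 - 10 * x ^ 4 + 20 * x ^ 5 - 20 * x ^ 6 - 20 * x ^ 8 +
      10 * x ^ 9 - 10 * x ^ 10) * h
  · linear_combination (28 - 20 * x + 4 * x ^ 2 + 4 * x ^ 3 + 4 * x ^ 4 - 8 * x ^ 5 + 8 * x ^ 6 + 8 * x ^ 8 - 4 * x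
      ^ 9 + 4 * x ^ 10) * h
  · linear_combination (-42 + 30 * x - 6 * x ^ 2 - 6 * x ^ 3 - 6 * x ^ 4 + 12 * x ^ 5 - 12 * x ^ 6 - 12 * x ^ 8 + 6
      * x ^ 9 - 6 * x ^ 10) * h
  · linear_combination (-x ^ 2 + x ^ 3 - x ^ 5 + 2 * x ^ 7 - x ^ 8 + x ^ 11 - x ^ 12 + x ^ 13 - x ^ 14 - x ^ 18 +
        x ^ 19) * h
  · linear_combination (1 + x - 2 * x ^ 2 + 2 * x ^ 3 - 2 * x ^ 4 + x ^ 5 - x ^ 6 + 2 * x ^ 7 + x ^ 9 - 4 * x ^ 10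
        + 3 * x ^ 11 - 3 * x ^ 12 + 2 * x ^ 13 - x ^ 14 + x ^ 15 - x ^ 16 + 2 * x ^ 17 - x ^ 18 +
        x ^ 21 - x ^ 22) * h
  · linear_combination (2 + 2 * x - 4 * x ^ 4 + 4 * x ^ 5 - x ^ 6 - 2 * x ^ 7 - x ^ 8 + 4 * x ^ 9 - 4 * x ^ 10 + 2
        * x ^ 11 - 2 * x ^ 12 + 2 * x ^ 13 + 2 * x ^ 15 - 2 * x ^ 16 + x ^ 19 - 2 * x ^ 20 + x ^
        21) * h
  · linear_combination (2 * x ^ 2 - 2 * x ^ 3 + 2 * x ^ 5 - 3 * x ^ 7 - x ^ 8 + 2 * x ^ 9 - x ^ 10 + x ^ 12 + x ^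
        15 - 2 * x ^ 16 + x ^ 17 + x ^ 19 - x ^ 20) * h
  · linear_combination (1 + x - 2 * x ^ 4 + 2 * x ^ 5 - 2 * x ^ 7 + 2 * x ^ 9 - 2 * x ^ 10 + x ^ 11 - x ^ 12 + x ^
        13 + x ^ 15 - x ^ 16) * h
  · linear_combination (1 + x - x ^ 2 + x ^ 3 - 2 * x ^ 4 + x ^ 5 - x ^ 6 + x ^ 7 + x ^ 9 - x ^ 10 - x ^ 12 + 2 *
        x ^ 13 - x ^ 14 + x ^ 16 - x ^ 17 - x ^ 20 + x ^ 21) * h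
  · linear_combination (2 + 2 * x - 5 * x ^ 2 + 6 * x ^ 3 - 5 * x ^ 4 - x ^ 5 + 6 * x ^ 7 - 3 * x ^ 8 + 3 * x ^ 9
        - 5 * x ^ 10 + 5 * x ^ 11 - 6 * x ^ 12 + 6 * x ^ 13 - 4 * x ^ 14 + x ^ 15 + x ^ 17 - 4 * x
        ^ 18 + 3 * x ^ 19 + x ^ 23 - x ^ 24) * h
  · linear_combination (-x ^ 2 + x ^ 3 - x ^ 4 + 2 * x ^ 7 - x ^ 9 + 2 * x ^ 11 - 3 * x ^ 12 + 2 * x ^ 13 - 2 * x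
        ^ 14 + 2 * x ^ 15 - x ^ 16 - x ^ 22 + x ^ 23) * h
  · linear_combination (-3 * x ^ 2 + 3 * x ^ 3 - 3 * x ^ 5 - x ^ 6 + 7 * x ^ 7 - x ^ 8 - x ^ 9 - x ^ 10 + 2 * x ^
        11 - 2 * x ^ 12 + x ^ 13 - x ^ 14 - x ^ 15 + x ^ 16 + x ^ 17 - 2 * x ^ 18 + x ^ 19 - x ^
        20 + x ^ 21) * h
  · linear_combination (1 + x - 2 * x ^ 2 + 2 * x ^ 3 - 2 * x ^ 4 + 2 * x ^ 7 - x ^ 8 + x ^ 9 - 2 * x ^ 10 + 3 * x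
        ^ 11 - 3 * x ^ 12 + x ^ 13 + x ^ 15 - x ^ 16 - x ^ 18 + x ^ 19) * h
  · linear_combination (-2 - 2 * x + 2 * x ^ 2 - 2 * x ^ 3 + 4 * x ^ 4 - 2 * x ^ 5 - x ^ 9 + 2 * x ^ 10 - 2 * x ^
        11 + 3 * x ^ 12 - 2 * x ^ 13 - x ^ 15 + 2 * x ^ 17 - x ^ 18) * h
  · linear_combination (1 + x - x ^ 2 + x ^ 3 - 2 * x ^ 4 + x ^ 5 + x ^ 9 - 2 * x ^ 10 + x ^ 11 - 2 * x ^ 12 + 5 *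
        x ^ 13 - 4 * x ^ 14 + x ^ 15) * h
  · linear_combination (3 + 3 * x - 3 * x ^ 2 + 3 * x ^ 3 - 6 * x ^ 4 + 4 * x ^ 5 - x ^ 6 + 3 * x ^ 9 - 5 * x ^ 10
        + 2 * x ^ 11 - 3 * x ^ 12 + 2 * x ^ 13 + x ^ 14 + x ^ 16 - x ^ 17 + x ^ 21 - x ^ 22) * h
  · linear_combination (x ^ 2 - x ^ 3 + x ^ 5 - 2 * x ^ 7 + x ^ 9 + x ^ 10 - 2 * x ^ 11 + x ^ 12 - x ^ 13 + x ^ 14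
        + x ^ 16 - x ^ 17) * h
  · linear_combination (1 + x - 2 * x ^ 4 + 2 * x ^ 5 - x ^ 7 - x ^ 8 + 3 * x ^ 9 - 4 * x ^ 10 + x ^ 11 + x ^ 13 -
        x ^ 16 + 2 * x ^ 17 - x ^ 18 + x ^ 19 - x ^ 20) * h
  · linear_combination (-1 - x + 2 * x ^ 2 - 2 * x ^ 3 + 2 * x ^ 4 - 2 * x ^ 7 + x ^ 8 - x ^ 9 + 2 * x ^ 10 - 2 *
        x ^ 11 + x ^ 12 - x ^ 14 + x ^ 15 + x ^ 18 - x ^ 19) * h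
  · linear_combination (-1 - x + x ^ 2 - x ^ 3 + 2 * x ^ 4 - x ^ 5 - x ^ 9 + 2 * x ^ 10 - x ^ 11 + x ^ 12 - 2 * x
        ^ 13 + x ^ 14) * h
  · linear_combination (-1 - x + 2 * x ^ 4 - 2 * x ^ 5 + 2 * x ^ 7 - 2 * x ^ 9 + x ^ 10 + 2 * x ^ 11 - 2 * x ^ 12
        - x ^ 14 + 2 * x ^ 15 - 2 * x ^ 16 + x ^ 17) * h
  · linear_combination (2 + 2 * x - 4 * x ^ 2 + 4 * x ^ 3 - 4 * x ^ 4 + 4 * x ^ 7 - x ^ 9 - 3 * x ^ 10 + 4 * x ^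
        11 - 3 * x ^ 12 + x ^ 13 + x ^ 14 - x ^ 15 - x ^ 17 + x ^ 18) * h
  · linear_combination (-3 - 3 * x + x ^ 2 - x ^ 3 + 6 * x ^ 4 - 5 * x ^ 5 - x ^ 6 + 5 * x ^ 7 - 5 * x ^ 9 + 6 * x
        ^ 10 - x ^ 11 + x ^ 12 - 6 * x ^ 13 + 3 * x ^ 14 - x ^ 20 + x ^ 21) * h

lemma Gs_zero_fourierVec {x : ℂ}
    (h : 1 + x + x ^ 2 + x ^ 3 + x ^ 4 + x ^ 5 + x ^ 6 + x ^ 7 + x ^ 8 + x ^ 9 + x ^ 10 + x ^ 11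
      + x ^ 12 = 0) (v : Fin 6 → ℂ) :
    Gs 0 (fourierVec x v) = 13 * (-13 * Gs 0 v + ∑ j ∈ Finset.Icc 1 12, Gs j v) := by
  obtain ⟨a, b, α, α', γ, γ', haa, hαα, hγγ, hαγ, hαγ', haα, hbα, haγ, hbγ, hD⟩ := D_fourierVec h
  obtain ⟨h0, h1⟩ := hD v
  have hs : ∑ j ∈ Finset.Icc 1 12, Gs j v = Gs 1 v + Gs 2 v + Gs 3 v + Gs 4 v + Gs 5 v + Gs 6 v
      + Gs 7 v + Gs 8 v + Gs 9 v + Gs 10 v + Gs 11 v + Gs 12 v := by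
    simp [Finset.sum_Icc_succ_top]
  rw [hs]
  simp only [Gs, h0, h1]
  generalize D 0 v = d0, D 1 v = d1, D 2 v = d2, D 3 v = d3, D 4 v = d4, D 5 v = d5, D 6 v = d6,
    D 7 v = d7, D 8 v = d8, D 9 v = d9, D 10 v = d10, D 11 v = d11, D 12 v = d12, Dinf v = di
  linear_combination (d0 ^ 2 + di ^ 2) * haa + ((d1 + d3 + d9) ^ 2 + (d4 + d10 + d12) ^ 2) * hαα
    + ((d2 + d5 + d6) ^ 2 + (d7 + d8 + d11) ^ 2) * hγγ
    + 2 * (d0 * (d1 + d3 + d9) - di * (d4 + d10 + d12)) * haα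
    + 2 * (d0 * (d4 + d10 + d12) + di * (d1 + d3 + d9)) * hbα
    + 2 * (d0 * (d2 + d5 + d6) - di * (d7 + d8 + d11)) * haγ
    + 2 * (d0 * (d7 + d8 + d11) + di * (d2 + d5 + d6)) * hbγ
    + 2 * ((d1 + d3 + d9) * (d2 + d5 + d6) + (d4 + d10 + d12) * (d7 + d8 + d11)) * hαγ
    + 2 * ((d4 + d10 + d12) * (d2 + d5 + d6) - (d1 + d3 + d9) * (d7 + d8 + d11)) * hαγ'

/-- The action of the diagonal torus of order `13`. -/
def torusVec (r : ℂ) (v : Fin 6 → ℂ) : Fin 6 → ℂ :=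
  ![r ^ 7 * v 0, r ^ 11 * v 1, r ^ 8 * v 2, r ^ 6 * v 3, r ^ 2 * v 4, r ^ 5 * v 5]

lemma A_torusVec {r : ℂ} (hr : r ^ 13 = 1) (v : Fin 6 → ℂ) :
    A 0 (torusVec r v) = A 0 v ∧
    A 1 (torusVec r v) = r * A 1 v ∧
    A 2 (torusVec r v) = r ^ 4 * A 2 v ∧
    A 3 (torusVec r v) = r ^ 9 * A 3 v ∧
    A 4 (torusVec r v) = r ^ 3 * A 4 v ∧
    A 5 (torusVec r v) = r ^ 12 * A 5 v ∧
    A 6 (torusVec r v) = r ^ 10 * A 6 v := by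
  simp only [A, torusVec, Matrix.cons_val]
  refine ⟨?_, ?_, ?_, ?_, ?_, ?_, ?_⟩
  · linear_combination (v 0 * v 3 + v 1 * v 4 + v 2 * v 5) * hr
  · linear_combination (r * v 0 ^ 2 - 2 * r * v 2 * v 3) * hr
  · linear_combination (-2 * r ^ 4 * v 1 * v 3) * hr
  · linear_combination (r ^ 9 * v 1 ^ 2) * hr
  · linear_combination (-2 * r ^ 3 * v 1 * v 5 + r ^ 3 * v 2 ^ 2) * hr
  · ring
  · ring

lemma D_torusVec {r : ℂ} (hr : r ^ 13 = 1) (v : Fin 6 → ℂ) :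
    D 0 (torusVec r v) = D 0 v ∧
    D 1 (torusVec r v) = r * D 1 v ∧
    D 2 (torusVec r v) = r ^ 2 * D 2 v ∧
    D 3 (torusVec r v) = r ^ 3 * D 3 v ∧
    D 4 (torusVec r v) = r ^ 4 * D 4 v ∧
    D 5 (torusVec r v) = r ^ 5 * D 5 v ∧
    D 6 (torusVec r v) = r ^ 6 * D 6 v ∧
    D 7 (torusVec r v) = r ^ 7 * D 7 v ∧
    D 8 (torusVec r v) = r ^ 8 * D 8 v ∧
    D 9 (torusVec r v) = r ^ 9 * D 9 v ∧
    D 10 (torusVec r v) = r ^ 10 * D 10 v ∧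
    D 11 (torusVec r v) = r ^ 11 * D 11 v ∧
    D 12 (torusVec r v) = r ^ 12 * D 12 v ∧
    Dinf (torusVec r v) = Dinf v := by
  simp only [D, Dinf, torusVec, Matrix.cons_val]
  refine ⟨?_, ?_, ?_, ?_, ?_, ?_, ?_, ?_, ?_, ?_, ?_, ?_, ?_, ?_⟩
  · linear_combination (r ^ 13 * v 0 * v 1 * v 2 + v 0 * v 1 * v 2) * hr
  · linear_combination (r ^ 14 * v 1 ^ 2 * v 5 + 2 * r ^ 14 * v 1 * v 2 ^ 2 + r * v 0 * v 4 * v 5 + r * v 1 ^ 2 * v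
      5 + 2 * r * v 1 * v 2 ^ 2 - r * v 3 ^ 2 * v 4) * hr
  · linear_combination (r ^ 15 * v 1 ^ 2 * v 3 + r ^ 2 * v 0 * v 3 * v 4 + r ^ 2 * v 1 ^ 2 * v 3 - 2 * r ^ 2 * v 1 *
      v 4 ^ 2 + 3 * r ^ 2 * v 2 * v 4 * v 5 - r ^ 2 * v 5 ^ 3) * hr
  · linear_combination (2 * r ^ 16 * v 0 * v 1 ^ 2 + r ^ 3 * v 0 ^ 2 * v 4 + 2 * r ^ 3 * v 0 * v 1 ^ 2 + r ^ 3 * v 2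
      * v 3 * v 4 - r ^ 3 * v 3 * v 5 ^ 2) * hr
  · linear_combination (-r ^ 17 * v 1 ^ 2 * v 2 - r ^ 4 * v 0 * v 2 * v 4 + r ^ 4 * v 0 * v 5 ^ 2 - r ^ 4 * v 1 ^ 2
      * v 2 - 2 * r ^ 4 * v 3 ^ 2 * v 5) * hr
  · linear_combination (3 * r ^ 5 * v 0 * v 3 * v 5 + r ^ 5 * v 1 * v 4 * v 5 + r ^ 5 * v 2 ^ 2 * v 4 - 2 * r ^ 5 *
      v 2 * v 5 ^ 2 - r ^ 5 * v 3 ^ 3) * hr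
  · linear_combination (r ^ 6 * v 0 ^ 2 * v 5 - 2 * r ^ 6 * v 0 * v 3 ^ 2 + 3 * r ^ 6 * v 1 * v 3 * v 4 + r ^ 6 * v
      2 * v 3 * v 5) * hr
  · linear_combination (-r ^ 20 * v 1 ^ 3 + 2 * r ^ 7 * v 0 ^ 2 * v 3 - 3 * r ^ 7 * v 0 * v 1 * v 4 - r ^ 7 * v 0 *
      v 2 * v 5 - r ^ 7 * v 1 ^ 3 + r ^ 7 * v 2 * v 3 ^ 2) * hr
  · linear_combination (-r ^ 8 * v 0 ^ 3 - 3 * r ^ 8 * v 0 * v 2 * v 3 - r ^ 8 * v 1 * v 2 * v 4 + r ^ 8 * v 1 * v 5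
      ^ 2 + 2 * r ^ 8 * v 2 ^ 2 * v 5) * hr
  · linear_combination (2 * r ^ 9 * v 0 ^ 2 * v 2 + r ^ 9 * v 1 * v 3 * v 5 + r ^ 9 * v 2 ^ 2 * v 3) * hr
  · linear_combination (-r ^ 10 * v 0 * v 1 * v 5 - r ^ 10 * v 0 * v 2 ^ 2 + r ^ 10 * v 1 * v 3 ^ 2) * hr
  · linear_combination (-r ^ 11 * v 0 * v 1 * v 3 + 2 * r ^ 11 * v 1 ^ 2 * v 4 - 3 * r ^ 11 * v 1 * v 2 * v 5 - r ^
      11 * v 2 ^ 3) * hr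
  · linear_combination (-r ^ 12 * v 0 ^ 2 * v 1 - r ^ 12 * v 1 * v 2 * v 3) * hr
  · linear_combination (v 3 * v 4 * v 5) * hr

lemma Gs_torusVec {r : ℂ} (hr : r ^ 13 = 1) (v : Fin 6 → ℂ) {j : ℕ} (hj : j < 13) :
    Gs j (torusVec r v) = r ^ j * Gs j v := by
  obtain ⟨h0, h1, h2, h3, h4, h5, h6, h7, h8, h9, h10, h11, h12, hi⟩ := D_torusVec hr v
  interval_cases j <;> simp only [Gs, h0, h1, h2, h3, h4, h5, h6, h7, h8, h9, h10, h11, h12, hi]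
  all_goals
    generalize D 0 v = d0, D 1 v = d1, D 2 v = d2, D 3 v = d3, D 4 v = d4, D 5 v = d5,
      D 6 v = d6, D 7 v = d7, D 8 v = d8, D 9 v = d9, D 10 v = d10, D 11 v = d11,
      D 12 v = d12, Dinf v = di
  · ring
  · linear_combination r * (2 * d2 * d12 - 2 * d3 * d11 - 4 * d4 * d10 - 2 * d5 * d9 - d7 ^ 2) * hr
  · linear_combination r ^ 2 * (-2 * d4 * d11 + 2 * d5 * d10 - 2 * d6 * d9 - 2 * d7 * d8) * hr
  · linear_combination r ^ 3 * (-4 * d4 * d12 + 2 * d6 * d10 - 2 * d7 * d9 - d8 ^ 2) * hr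
  · linear_combination r ^ 4 * (2 * d5 * d12 - 2 * d7 * d10 - 2 * d8 * d9) * hr
  · linear_combination r ^ 5 * (2 * d6 * d12 - 2 * d7 * d11 - 2 * d8 * d10 - 2 * d9 ^ 2) * hr
  · linear_combination r ^ 6 * (-2 * d7 * d12 - 2 * d8 * d11) * hr
  · linear_combination r ^ 7 * (-2 * d8 * d12 - 2 * d9 * d11 - 2 * d10 ^ 2) * hr
  · linear_combination r ^ 8 * (-2 * d10 * d11) * hr
  · linear_combination r ^ 9 * (-4 * d10 * d12 - d11 ^ 2) * hr
  · linear_combination r ^ 10 * (-2 * d11 * d12) * hr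
  · linear_combination r ^ 11 * (-2 * d12 ^ 2) * hr
  · ring

/-! ### Invariance of the forms `Φ₁₂`, `Φ₂₀`, `Φ₃₀` -/

lemma sum_zmod13_eq_sum_range (F : ℕ → ℂ) :
    ∑ ν : ZMod 13, F ν.val = ∑ ν ∈ Finset.range 13, F ν :=
  Fin.sum_univ_eq_sum_range F 13

lemma oddCoords_weilT (ν : ZMod 13) (f : ZMod 13 → ℂ) :
    oddCoords (weilT ν f) = torusVec (ζ ^ ν.val) (oddCoords f) := by
  have key (n : ℕ) : ZMod.stdAddChar (ν * (n : ZMod 13)) = (ζ ^ ν.val) ^ n := by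
    rw [mul_comm, ← nsmul_eq_mul, AddChar.map_nsmul_eq_pow, stdAddChar_eq_zeta13_pow]
  have hk (k : ZMod 13) (n : ℕ) (h : 5 * k ^ 2 = (n : ZMod 13)) :
      weilT ν f k = (ζ ^ ν.val) ^ n * f k := by
    rw [weilT, ← key, ← h]
    ring_nf
  rw [oddCoords, torusVec, hk 2 7 rfl, hk 6 11 rfl, hk 5 8 rfl, hk 3 6 rfl, hk 4 2 rfl,
    hk 1 5 rfl, ← mul_neg]
  rfl

lemma oddCoords_smul (c : ℂ) (f : ZMod 13 → ℂ) : oddCoords (c • f) = c • oddCoords f := by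
  simp [oddCoords]

lemma zeta13_pow_pow_thirteen (n : ℕ) : (ζ ^ n) ^ 13 = 1 := by
  rw [pow_right_comm, zeta13_pow_thirteen, one_pow]

lemma A_zero_smul (c : ℂ) (v : Fin 6 → ℂ) : A 0 (c • v) = c ^ 2 * A 0 v := by
  simp only [A, Pi.smul_apply, smul_eq_mul]
  ring

lemma Gs_zero_smul (c : ℂ) (v : Fin 6 → ℂ) : Gs 0 (c • v) = c ^ 6 * Gs 0 v := by
  simp only [Gs, D, Dinf, Pi.smul_apply, smul_eq_mul]
  ring

lemma comp_mul_invariant {Q : (Fin 6 → ℂ) → ℂ}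
    (hQ : ∀ v, Q ![-v 4, -v 5, -v 3, v 1, v 2, v 0] = Q v) {c : ZMod 13} (hc : c ≠ 0)
    {f : ZMod 13 → ℂ} (hf : ∀ k, f (-k) = -f k) :
    Q (oddCoords fun k ↦ f (c * k)) = Q (oddCoords f) := by
  have h2 : ∀ c : ZMod 13, c ≠ 0 → ∃ n : Fin 12, c = 2 ^ n.val := by decide
  obtain ⟨n, rfl⟩ := h2 c hc
  induction n.val with
  | zero => simp
  | succ m ih =>
    refine Eq.trans (congrArg Q ?_) ((hQ _).trans ih)
    have e (k : ZMod 13) : f (2 ^ m * -k) = -f (2 ^ m * k) := by rw [mul_neg, hf]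
    simp only [pow_succ, mul_assoc]
    simp only [oddCoords, Matrix.cons_val, neg_neg, ← e]
    rfl

lemma w_eq_A_zero_weilS (ν : ZMod 13) {f : ZMod 13 → ℂ} (hf : ∀ k, f (-k) = -f k) :
    w ν.val (oddCoords f) = A 0 (oddCoords (weilS (weilT ν f))) ^ 2 / 13 := by
  rw [← oddExtension_oddCoords (weilT_neg hf ν), oddCoords_weilS,
    A_zero_fourierVec zeta13_isPrimitiveRoot.sum_pow_thirteen, oddCoords_weilT]
  obtain ⟨h0, h1, h2, h3, h4, h5, h6⟩ := A_torusVec (zeta13_pow_pow_thirteen ν.val) (oddCoords f)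
  rw [h0, h1, h2, h3, h4, h5, h6, w]
  simp only [← pow_mul, mul_comm]
  ring

lemma deltaF_eq_Gs_zero_weilS (ν : ZMod 13) {f : ZMod 13 → ℂ} (hf : ∀ k, f (-k) = -f k) :
    deltaF ν.val (oddCoords f) = Gs 0 (oddCoords (weilS (weilT ν f))) / 13 := by
  rw [← oddExtension_oddCoords (weilT_neg hf ν), oddCoords_weilS,
    Gs_zero_fourierVec zeta13_isPrimitiveRoot.sum_pow_thirteen, oddCoords_weilT]
  have h := fun j hj ↦ Gs_torusVec (zeta13_pow_pow_thirteen ν.val) (oddCoords f) (j := j) hj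
  rw [h 0 (by norm_num), Finset.sum_congr rfl fun j hj ↦ h j (by simp at hj; omega), deltaF]
  simp only [← pow_mul, mul_comm]
  ring

lemma sum_w_pow (n : ℕ) {f : ZMod 13 → ℂ} (hf : ∀ k, f (-k) = -f k) :
    (∑ ν ∈ Finset.range 13, w ν (oddCoords f) ^ n) + winf (oddCoords f) ^ n =
      (∑ ν, (A 0 (oddCoords (weilS (weilT ν f))) ^ 2 / 13) ^ n)
        + (13 ^ 1 * A 0 (oddCoords f) ^ 2) ^ n := by
  rw [← sum_zmod13_eq_sum_range fun ν ↦ w ν (oddCoords f) ^ n, winf, pow_one]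
  simp only [w_eq_A_zero_weilS _ hf]

lemma sum_deltaF_pow (n : ℕ) {f : ZMod 13 → ℂ} (hf : ∀ k, f (-k) = -f k) :
    (∑ ν ∈ Finset.range 13, deltaF ν (oddCoords f) ^ n) + deltaInf (oddCoords f) ^ n =
      (∑ ν, (Gs 0 (oddCoords (weilS (weilT ν f))) / 13) ^ n)
        + (13 ^ 2 * Gs 0 (oddCoords f)) ^ n := by
  rw [← sum_zmod13_eq_sum_range fun ν ↦ deltaF ν (oddCoords f) ^ n, deltaInf]
  simp only [deltaF_eq_Gs_zero_weilS _ hf]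

lemma A_zero_sq_comp_mul {c : ZMod 13} (hc : c ≠ 0) {f : ZMod 13 → ℂ}
    (hf : ∀ k, f (-k) = -f k) :
    A 0 (oddCoords fun k ↦ f (c * k)) ^ 2 = A 0 (oddCoords f) ^ 2 := by
  refine comp_mul_invariant (Q := fun v ↦ A 0 v ^ 2) (fun v ↦ ?_) hc hf
  simp only [A, Matrix.cons_val]
  ring

lemma Gs_zero_comp_mul {c : ZMod 13} (hc : c ≠ 0) {f : ZMod 13 → ℂ}
    (hf : ∀ k, f (-k) = -f k) :
    Gs 0 (oddCoords fun k ↦ f (c * k)) = Gs 0 (oddCoords f) := by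
  refine comp_mul_invariant (Q := Gs 0) (fun v ↦ ?_) hc hf
  simp only [Gs, D, Dinf, Matrix.cons_val]
  ring

lemma A_zero_sq_weilT (ν : ZMod 13) (f : ZMod 13 → ℂ) :
    A 0 (oddCoords (weilT ν f)) ^ 2 = A 0 (oddCoords f) ^ 2 := by
  rw [oddCoords_weilT, (A_torusVec (zeta13_pow_pow_thirteen ν.val) _).1]

lemma Gs_zero_weilT (ν : ZMod 13) (f : ZMod 13 → ℂ) :
    Gs 0 (oddCoords (weilT ν f)) = Gs 0 (oddCoords f) := by
  rw [oddCoords_weilT, Gs_torusVec (zeta13_pow_pow_thirteen ν.val) _ (by norm_num), pow_zero,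
    one_mul]

lemma sum_w_pow_fourierVec (n : ℕ) (v : Fin 6 → ℂ) :
    (∑ ν ∈ Finset.range 13, w ν (fourierVec ζ v) ^ n) + winf (fourierVec ζ v) ^ n =
      13 ^ (2 * n) * ((∑ ν ∈ Finset.range 13, w ν v ^ n) + winf v ^ n) := by
  have hf := oddExtension_neg v
  have h := sum_weilS_weilT_invariant (Q := fun f ↦ A 0 (oddCoords f) ^ 2) (e := 1) n
    (fun c f ↦ by rw [oddCoords_smul, A_zero_smul]; ring) A_zero_sq_weilT
    (fun c f hc hf ↦ A_zero_sq_comp_mul hc hf) hf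
  rw [← sum_w_pow n (weilS_neg hf), ← sum_w_pow n hf, oddCoords_weilS,
    oddCoords_oddExtension] at h
  exact h

lemma sum_deltaF_pow_fourierVec (n : ℕ) (v : Fin 6 → ℂ) :
    (∑ ν ∈ Finset.range 13, deltaF ν (fourierVec ζ v) ^ n) + deltaInf (fourierVec ζ v) ^ n =
      13 ^ (3 * n) * ((∑ ν ∈ Finset.range 13, deltaF ν v ^ n) + deltaInf v ^ n) := by
  have hf := oddExtension_neg v
  have h := sum_weilS_weilT_invariant (Q := fun f ↦ Gs 0 (oddCoords f)) (e := 2) n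
    (fun c f ↦ by rw [oddCoords_smul, Gs_zero_smul]) Gs_zero_weilT
    (fun c f hc hf ↦ Gs_zero_comp_mul hc hf) hf
  rw [← sum_deltaF_pow n (weilS_neg hf), ← sum_deltaF_pow n hf, oddCoords_weilS,
    oddCoords_oddExtension] at h
  exact h

lemma sum_w_pow_torusVec (n : ℕ) (μ : ZMod 13) (v : Fin 6 → ℂ) :
    (∑ ν ∈ Finset.range 13, w ν (torusVec (ζ ^ μ.val) v) ^ n)
      + winf (torusVec (ζ ^ μ.val) v) ^ n =
      (∑ ν ∈ Finset.range 13, w ν v ^ n) + winf v ^ n := by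
  have hf := oddExtension_neg v
  have h1 := sum_w_pow n (weilT_neg hf μ)
  have h2 := sum_w_pow n hf
  rw [sum_weilS_weilT_weilT (Q := fun f ↦ A 0 (oddCoords f) ^ 2) (fun t ↦ (t / 13) ^ n),
    A_zero_sq_weilT, ← h2, oddCoords_weilT, oddCoords_oddExtension] at h1
  exact h1

lemma sum_deltaF_pow_torusVec (n : ℕ) (μ : ZMod 13) (v : Fin 6 → ℂ) :
    (∑ ν ∈ Finset.range 13, deltaF ν (torusVec (ζ ^ μ.val) v) ^ n)
      + deltaInf (torusVec (ζ ^ μ.val) v) ^ n =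
      (∑ ν ∈ Finset.range 13, deltaF ν v ^ n) + deltaInf v ^ n := by
  have hf := oddExtension_neg v
  have h1 := sum_deltaF_pow n (weilT_neg hf μ)
  have h2 := sum_deltaF_pow n hf
  rw [sum_weilS_weilT_weilT (Q := fun f ↦ Gs 0 (oddCoords f)) (fun t ↦ (t / 13) ^ n),
    Gs_zero_weilT, ← h2, oddCoords_weilT, oddCoords_oddExtension] at h1
  exact h1

lemma sum_w_pow_smul (n : ℕ) (c : ℂ) (v : Fin 6 → ℂ) :
    (∑ ν ∈ Finset.range 13, w ν (c • v) ^ n) + winf (c • v) ^ n =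
      c ^ (4 * n) * ((∑ ν ∈ Finset.range 13, w ν v ^ n) + winf v ^ n) := by
  have h1 (ν : ℕ) : w ν (c • v) = c ^ 4 * w ν v := by
    simp only [w, A, Pi.smul_apply, smul_eq_mul]
    ring
  have h2 : winf (c • v) = c ^ 4 * winf v := by
    rw [winf, A_zero_smul, winf]
    ring
  simp only [h1, h2, mul_pow, ← pow_mul, mul_add, Finset.mul_sum]

lemma sum_deltaF_pow_smul (n : ℕ) (c : ℂ) (v : Fin 6 → ℂ) :
    (∑ ν ∈ Finset.range 13, deltaF ν (c • v) ^ n) + deltaInf (c • v) ^ n =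
      c ^ (6 * n) * ((∑ ν ∈ Finset.range 13, deltaF ν v ^ n) + deltaInf v ^ n) := by
  have h0 {j : ℕ} (hj : j < 13) : D j (c • v) = c ^ 3 * D j v := by
    interval_cases j <;> simp only [D, Pi.smul_apply, smul_eq_mul] <;> ring
  have hi : Dinf (c • v) = c ^ 3 * Dinf v := by
    simp only [Dinf, Pi.smul_apply, smul_eq_mul]
    ring
  have hG {j : ℕ} (hj : j < 13) : Gs j (c • v) = c ^ 6 * Gs j v := by
    interval_cases j <;> simp only [Gs, h0, hi, Nat.reduceLT] <;> ring
  have h1 (ν : ℕ) : deltaF ν (c • v) = c ^ 6 * deltaF ν v := by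
    simp only [deltaF, mul_add, Finset.mul_sum]
    rw [hG (by norm_num)]
    congr 1
    · ring
    · refine Finset.sum_congr rfl fun j hj ↦ ?_
      rw [hG (by simp at hj; omega)]
      ring
  have h2 : deltaInf (c • v) = c ^ 6 * deltaInf v := by
    rw [deltaInf, hG (by norm_num), deltaInf]
    ring
  simp only [h1, h2, mul_pow, ← pow_mul, mul_add, Finset.mul_sum]

lemma Phi20_fourierVec (v : Fin 6 → ℂ) : Phi20 (fourierVec ζ v) = 13 ^ 10 * Phi20 v := by
  rw [Phi20, sum_w_pow_fourierVec, Phi20]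
  ring

lemma Phi12_fourierVec (v : Fin 6 → ℂ) : Phi12 (fourierVec ζ v) = 13 ^ 6 * Phi12 v := by
  rw [Phi12, sum_deltaF_pow_fourierVec, Phi12]
  ring

lemma Phi30_fourierVec (v : Fin 6 → ℂ) : Phi30 (fourierVec ζ v) = 13 ^ 15 * Phi30 v := by
  rw [Phi30, sum_deltaF_pow_fourierVec, Phi30]
  ring

lemma Phi20_torusVec (v : Fin 6 → ℂ) : Phi20 (torusVec ζ v) = Phi20 v := by
  have h := sum_w_pow_torusVec 5 1 v
  rw [show (1 : ZMod 13).val = 1 from rfl, pow_one] at h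
  rw [Phi20, h, Phi20]

lemma Phi12_torusVec (v : Fin 6 → ℂ) : Phi12 (torusVec ζ v) = Phi12 v := by
  have h := sum_deltaF_pow_torusVec 2 1 v
  rw [show (1 : ZMod 13).val = 1 from rfl, pow_one] at h
  rw [Phi12, h, Phi12]

lemma Phi30_torusVec (v : Fin 6 → ℂ) : Phi30 (torusVec ζ v) = Phi30 v := by
  have h := sum_deltaF_pow_torusVec 5 1 v
  rw [show (1 : ZMod 13).val = 1 from rfl, pow_one] at h
  rw [Phi30, h, Phi30]

lemma Phi20_smul (c : ℂ) (v : Fin 6 → ℂ) : Phi20 (c • v) = c ^ 20 * Phi20 v := by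
  rw [Phi20, sum_w_pow_smul, Phi20]
  ring

lemma Phi12_smul (c : ℂ) (v : Fin 6 → ℂ) : Phi12 (c • v) = c ^ 12 * Phi12 v := by
  rw [Phi12, sum_deltaF_pow_smul, Phi12]
  ring

lemma Phi30_smul (c : ℂ) (v : Fin 6 → ℂ) : Phi30 (c • v) = c ^ 30 * Phi30 v := by
  rw [Phi30, sum_deltaF_pow_smul, Phi30]
  ring

/-! ### Transformation laws of the theta constants -/

/-- The theta series `∑ (-1)^n q^((26n+k)²/104)`. -/
def oddTheta (k : ℤ) (z : ℂ) : ℂ :=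
  ∑' n : ℤ, (-1 : ℂ) ^ n * cexp (2 * Real.pi * I * ((26 * n + k) ^ 2 / 104) * z)

lemma qp_mul_thetaSum (k : ℤ) (z : ℂ) :
    qp (k ^ 2 / 104) z * thetaSum k z = oddTheta k z := by
  rw [thetaSum, oddTheta, ← tsum_mul_left]
  refine tsum_congr fun n ↦ ?_
  rw [mul_left_comm, qp, qp, ← Complex.exp_add]
  congr 2
  push_cast
  ring

lemma Avec_eq_oddTheta (z : ℂ) :
    Avec z = ![oddTheta 11 z, oddTheta 7 z, oddTheta 5 z, -oddTheta 3 z, oddTheta 9 z,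
      oddTheta 1 z] := by
  simp only [← qp_mul_thetaSum]
  ext i
  fin_cases i <;> simp [Avec, thc] <;> norm_num

lemma neg_one_zpow_eq_exp (n : ℤ) : (-1 : ℂ) ^ n = cexp (2 * Real.pi * I * (n / 2)) := by
  rw [← Complex.exp_pi_mul_I, ← Complex.exp_int_mul]
  ring_nf

lemma oddTheta_eq_jacobiTheta₂ (k : ℤ) (z : ℂ) :
    oddTheta k z =
      cexp (2 * Real.pi * I * (k ^ 2 / 104) * z) * jacobiTheta₂ (1 / 2 + k * z / 2) (13 * z) := by
  rw [oddTheta, jacobiTheta₂, ← tsum_mul_left]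
  refine tsum_congr fun n ↦ ?_
  rw [jacobiTheta₂_term, neg_one_zpow_eq_exp, ← Complex.exp_add, ← Complex.exp_add]
  congr 1
  ring

lemma oddTheta_neg (k : ℤ) (z : ℂ) : oddTheta (-k) z = oddTheta k z := by
  rw [oddTheta, ← (Equiv.neg ℤ).tsum_eq, oddTheta]
  refine tsum_congr fun n ↦ ?_
  rw [Equiv.neg_apply, zpow_neg, ← inv_zpow, inv_neg_one]
  congr 2
  push_cast
  ring

lemma oddTheta_add (k : ℤ) (z : ℂ) : oddTheta (k + 26) z = -oddTheta k z := by
  rw [oddTheta, ← (Equiv.subRight (1 : ℤ)).tsum_eq, oddTheta, ← tsum_neg]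
  refine tsum_congr fun n ↦ ?_
  rw [Equiv.subRight_apply, zpow_sub₀ (by norm_num), ← neg_mul]
  congr 2
  · rw [zpow_one, div_neg, div_one]
  · push_cast
    ring

lemma oddTheta_sub (k : ℤ) (z : ℂ) : oddTheta (26 - k) z = -oddTheta k z := by
  rw [sub_eq_neg_add, oddTheta_add, oddTheta_neg]

lemma oddTheta_thirteen (z : ℂ) : oddTheta 13 z = 0 := by
  have := oddTheta_sub 13 z
  norm_num at this
  linear_combination this / 2

lemma oddTheta_add_one {k : ℤ} (hk : Odd k) (z : ℂ) :
    oddTheta k (z + 1) = cexp (2 * Real.pi * I * (k ^ 2 / 104)) * oddTheta k z := by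
  rw [oddTheta, oddTheta, ← tsum_mul_left]
  refine tsum_congr fun n ↦ ?_
  rw [mul_left_comm, ← Complex.exp_add]
  congr 1
  obtain ⟨m, hm⟩ : Even (n * (13 * n + k)) := by
    rcases Int.even_or_odd n with h | h
    · exact h.mul_right _
    · exact ((Odd.mul (by decide) h).add_odd hk).mul_left _
  have hm' : (n * (13 * n + k) : ℂ) = m + m := by exact_mod_cast hm
  rw [show 2 * Real.pi * I * ((26 * n + k) ^ 2 / 104) * (z + 1) =
    2 * Real.pi * I * (k ^ 2 / 104) + 2 * Real.pi * I * ((26 * n + k) ^ 2 / 104) * z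
      + m * (2 * Real.pi * I) by linear_combination (Real.pi * I) * hm']
  rw [Complex.exp_add, Complex.exp_int_mul_two_pi_mul_I, mul_one]

lemma zeta13_pow_eq_exp (n : ℕ) : ζ ^ n = cexp (2 * Real.pi * I * (n / 13)) := by
  rw [zeta13, ← Complex.exp_nat_mul]
  ring_nf

lemma Avec_add_one (z : ℂ) :
    Avec (z + 1) = cexp (2 * Real.pi * I * (5 / 8)) • torusVec ζ (Avec z) := by
  have key (k : ℤ) (hk : Odd k) (n : ℕ) (m : ℤ) (h : k ^ 2 - 65 = 8 * n + 104 * m) :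
      oddTheta k (z + 1) = cexp (2 * Real.pi * I * (5 / 8)) * (ζ ^ n * oddTheta k z) := by
    rw [oddTheta_add_one hk, zeta13_pow_eq_exp, ← mul_assoc, ← Complex.exp_add]
    have h' : (k ^ 2 - 65 : ℂ) = 8 * n + 104 * m := by exact_mod_cast h
    rw [show 2 * Real.pi * I * (k ^ 2 / 104) = 2 * Real.pi * I * (5 / 8)
      + 2 * Real.pi * I * (n / 13) + m * (2 * Real.pi * I) by
        linear_combination (2 * Real.pi * I / 104) * h']
    rw [Complex.exp_add _ (m * (2 * Real.pi * I)), Complex.exp_int_mul_two_pi_mul_I, mul_one]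
  rw [Avec_eq_oddTheta, Avec_eq_oddTheta, key 11 (by decide) 7 0 (by norm_num),
    key 7 (by decide) 11 (-1) (by norm_num), key 5 (by decide) 8 (-1) (by norm_num),
    key 3 (by decide) 6 (-1) (by norm_num), key 9 (by decide) 2 0 (by norm_num),
    key 1 (by decide) 5 (-1) (by norm_num)]
  simp [torusVec]

lemma tsum_int_eq_sum_tsum_thirteen {F : ℤ → ℂ} (hF : Summable F) :
    ∑' n, F n = ∑ j : Fin 13, ∑' n : ℤ, F (n * 13 + j.val) := by
  have hF' : Summable fun p : Fin 13 × ℤ ↦ F (p.2 * 13 + p.1.val) :=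
    hF.comp_injective (((Equiv.prodComm _ _).trans (Int.divModEquiv 13).symm).injective)
  rw [← tsum_fintype (L := SummationFilter.unconditional _), ← hF'.tsum_prod,
    ← ((Equiv.prodComm _ _).trans (Int.divModEquiv 13).symm).tsum_eq]
  rfl

lemma oddTheta_neg_inv_eq_tsum {k : ℤ} {z : ℂ} (hz : 0 < z.im) :
    oddTheta k (-1 / z) = 1 / (13 * I / z) ^ (1 / 2 : ℂ) *
      (cexp (2 * Real.pi * I * (z / 104 - k / 52)) *
        jacobiTheta₂ (k / 26 - z / 26) (z / 13)) := by
  have hz0 : z ≠ 0 := by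
    rintro rfl
    simp at hz
  rw [oddTheta_eq_jacobiTheta₂, jacobiTheta₂_functional_equation]
  have e1 : -I * (13 * (-1 / z)) = 13 * I / z := by ring
  have e2 : (1 / 2 + k * (-1 / z) / 2) / (13 * (-1 / z)) = (k / 26 - z / 26 : ℂ) := by
    field_simp
    ring
  have e3 : -1 / (13 * (-1 / z)) = z / 13 := by field_simp
  have e4 : cexp (2 * Real.pi * I * (z / 104 - k / 52)) =
      cexp (2 * Real.pi * I * (k ^ 2 / 104) * (-1 / z)) *
        cexp (-Real.pi * I * (1 / 2 + k * (-1 / z) / 2) ^ 2 / (13 * (-1 / z))) := by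
    rw [← Complex.exp_add]
    congr 1
    field_simp
    ring
  rw [e1, e2, e3, e4]
  ring

lemma oddTheta_neg_inv_eq_sum {k : ℤ} (hk : Odd k) {z : ℂ} (hz : 0 < z.im) :
    oddTheta k (-1 / z) = 1 / (13 * I / z) ^ (1 / 2 : ℂ) *
      ∑ j : Fin 13, cexp (2 * Real.pi * I * ((2 * (j.val : ℤ) - 1 : ℤ) * k / 52))
        * oddTheta (2 * (j.val : ℤ) - 1) z := by
  rw [oddTheta_neg_inv_eq_tsum hz]
  congr 1
  rw [jacobiTheta₂, tsum_int_eq_sum_tsum_thirteen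
    ((summable_jacobiTheta₂_term_iff _ _).2 (by simpa using hz)), Finset.mul_sum]
  refine Finset.sum_congr rfl fun j _ ↦ ?_
  rw [oddTheta, ← tsum_mul_left, ← tsum_mul_left]
  refine tsum_congr fun n ↦ ?_
  obtain ⟨m, rfl⟩ := hk
  rw [jacobiTheta₂_term, neg_one_zpow_eq_exp, ← Complex.exp_add, ← Complex.exp_add,
    ← Complex.exp_add, Complex.exp_eq_exp_iff_exists_int]
  refine ⟨n * m, ?_⟩
  push_cast
  ring

/-- The number `e(m/52) + e(-m/52)`. -/
def cosCoeff (m : ℤ) : ℂ :=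
  cexp (2 * Real.pi * I * (m / 52)) + cexp (2 * Real.pi * I * (-m / 52))

lemma cosCoeff_neg (m : ℤ) : cosCoeff (-m) = cosCoeff m := by
  simp [cosCoeff, add_comm]

lemma cosCoeff_eq_of_dvd {m : ℤ} {a b : ℕ} (h : (52 : ℤ) ∣ m - 13 - 4 * a)
    (hab : 13 ∣ a + b) : cosCoeff m = I * (ζ ^ a - ζ ^ b) := by
  obtain ⟨c, hc⟩ := hab
  obtain ⟨e, he⟩ := h
  have h' : (m - 13 - 4 * a : ℂ) = 52 * e := by exact_mod_cast he
  have hc' : (a + b : ℂ) = 13 * c := by exact_mod_cast hc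
  have hI : cexp (2 * Real.pi * I * (1 / 4)) = I := by
    rw [show 2 * Real.pi * I * (1 / 4) = Real.pi / 2 * I by ring, Complex.exp_pi_div_two_mul_I]
  have hI' : cexp (2 * Real.pi * I * (-1 / 4)) = -I := by
    rw [show 2 * Real.pi * I * (-1 / 4) = -(2 * Real.pi * I * (1 / 4)) by ring, Complex.exp_neg,
      hI, Complex.inv_I]
  have h1 : cexp (2 * Real.pi * I * (m / 52)) = I * ζ ^ a := by
    rw [zeta13_pow_eq_exp, eq_comm]
    refine (congrArg (· * _) hI.symm).trans ?_
    rw [← Complex.exp_add, eq_comm, Complex.exp_eq_exp_iff_exists_int]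
    exact ⟨e, by linear_combination (2 * Real.pi * I / 52) * h'⟩
  have h2 : cexp (2 * Real.pi * I * (-m / 52)) = -I * ζ ^ b := by
    rw [zeta13_pow_eq_exp, ← hI', ← Complex.exp_add, Complex.exp_eq_exp_iff_exists_int]
    exact ⟨-e - c, by
      push_cast
      linear_combination (-2 * Real.pi * I / 52) * h' - (2 * Real.pi * I / 13) * hc'⟩
  rw [cosCoeff, h1, h2]
  ring

lemma cosCoeff_eq {m : ℤ} {a b : ℕ} (h : (52 : ℤ) ∣ m - 13 - 4 * a ∨ (52 : ℤ) ∣ -m - 13 - 4 * a)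
    (hab : 13 ∣ a + b) : cosCoeff m = I * (ζ ^ a - ζ ^ b) := by
  rcases h with h | h
  · exact cosCoeff_eq_of_dvd h hab
  · rw [← cosCoeff_neg, cosCoeff_eq_of_dvd h hab]

lemma oddTheta_neg_inv {k : ℤ} (hk : Odd k) {z : ℂ} (hz : 0 < z.im) :
    oddTheta k (-1 / z) = 1 / (13 * I / z) ^ (1 / 2 : ℂ) *
      (cosCoeff k * oddTheta 1 z + cosCoeff (3 * k) * oddTheta 3 z +
        cosCoeff (5 * k) * oddTheta 5 z + cosCoeff (7 * k) * oddTheta 7 z +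
        cosCoeff (9 * k) * oddTheta 9 z + cosCoeff (11 * k) * oddTheta 11 z) := by
  have hE (r : ℤ) : cexp (2 * Real.pi * I * ((26 - r : ℤ) * k / 52)) =
      -cexp (2 * Real.pi * I * (-(r * k : ℤ) / 52)) := by
    obtain ⟨m, rfl⟩ := hk
    have : -cexp (2 * Real.pi * I * (-(r * (2 * m + 1) : ℤ) / 52)) =
        cexp (2 * Real.pi * I * (-(r * (2 * m + 1) : ℤ) / 52) + Real.pi * I) := by
      rw [Complex.exp_add, Complex.exp_pi_mul_I]
      ring
    rw [this, Complex.exp_eq_exp_iff_exists_int]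
    refine ⟨m, ?_⟩
    push_cast
    ring
  have hpair (r : ℤ) : cexp (2 * Real.pi * I * ((26 - r : ℤ) * k / 52)) * oddTheta (26 - r) z =
      cexp (2 * Real.pi * I * (-(r * k : ℤ) / 52)) * oddTheta r z := by
    rw [hE, oddTheta_sub]
    ring
  rw [oddTheta_neg_inv_eq_sum hk hz]
  congr 1
  have h3 := hpair 3
  have h5 := hpair 5
  have h7 := hpair 7
  have h9 := hpair 9
  have h11 := hpair 11
  have h1 := oddTheta_neg 1 z
  simp only [Fin.sum_univ_succ, cosCoeff]
  norm_num [oddTheta_thirteen] at h1 h3 h5 h7 h9 h11 ⊢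
  rw [h1, h3, h5, h7, h9, h11]
  ring_nf

lemma Avec_neg_inv {z : ℂ} (hz : 0 < z.im) :
    Avec (-1 / z) = (I / (13 * I / z) ^ (1 / 2 : ℂ)) • fourierVec ζ (Avec z) := by
  rw [Avec_eq_oddTheta, Avec_eq_oddTheta]
  have hrow {k : ℤ} (a b : Fin 6 → ℕ) (hk : Odd k)
      (ha : ∀ i : Fin 6, (52 : ℤ) ∣ (2 * i.val + 1) * k - 13 - 4 * a i ∨
        (52 : ℤ) ∣ -((2 * i.val + 1) * k) - 13 - 4 * a i)
      (hb : ∀ i, 13 ∣ a i + b i) :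
      oddTheta k (-1 / z) = I / (13 * I / z) ^ (1 / 2 : ℂ) *
        ((ζ ^ a 0 - ζ ^ b 0) * oddTheta 1 z + (ζ ^ a 1 - ζ ^ b 1) * oddTheta 3 z +
        (ζ ^ a 2 - ζ ^ b 2) * oddTheta 5 z + (ζ ^ a 3 - ζ ^ b 3) * oddTheta 7 z +
        (ζ ^ a 4 - ζ ^ b 4) * oddTheta 9 z + (ζ ^ a 5 - ζ ^ b 5) * oddTheta 11 z) := by
    have h (i : Fin 6) : cosCoeff ((2 * i.val + 1) * k) = I * (ζ ^ a i - ζ ^ b i) :=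
      cosCoeff_eq (ha i) (hb i)
    have h0 := h 0
    have h1 := h 1
    have h2 := h 2
    have h3 := h 3
    have h4 := h 4
    have h5 := h 5
    norm_num at h0 h1 h2 h3 h4 h5
    rw [oddTheta_neg_inv hk hz, h0, h1, h2, h3, h4, h5]
    ring
  rw [hrow (k := 11) ![7, 5, 9, 3, 11, 1] ![6, 8, 4, 10, 2, 12]
    (by decide) (by decide) (by decide)]
  rw [hrow (k := 7) ![8, 2, 1, 9, 7, 3] ![5, 11, 12, 4, 6, 10]
    (by decide) (by decide) (by decide)]
  rw [hrow (k := 5) ![11, 6, 3, 1, 8, 9] ![2, 7, 10, 12, 5, 4]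
    (by decide) (by decide) (by decide)]
  rw [hrow (k := 3) ![9, 12, 6, 2, 3, 5] ![4, 1, 7, 11, 10, 8]
    (by decide) (by decide) (by decide)]
  rw [hrow (k := 9) ![12, 3, 8, 7, 4, 11] ![1, 10, 5, 6, 9, 2]
    (by decide) (by decide) (by decide)]
  rw [hrow (k := 1) ![10, 9, 11, 8, 12, 7] ![3, 4, 2, 5, 1, 6]
    (by decide) (by decide) (by decide)]
  generalize I / (13 * I / z) ^ (1 / 2 : ℂ) = c
  ext i
  fin_cases i <;> simp [fourierVec, sineTransform, -mul_eq_mul_left_iff] <;> ring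

lemma div_cpow_half_sq {z : ℂ} (hz : 0 < z.im) :
    (I / (13 * I / z) ^ (1 / 2 : ℂ)) ^ 2 = I * z / 13 := by
  have hz0 : z ≠ 0 := by
    rintro rfl
    simp at hz
  rw [div_pow, one_div, show (2⁻¹ : ℂ) = ((2 : ℕ) : ℂ)⁻¹ by norm_num,
    Complex.cpow_nat_inv_pow _ two_ne_zero]
  field_simp

lemma Phi20_Avec_neg_inv {z : ℂ} (hz : 0 < z.im) :
    Phi20 (Avec (-1 / z)) = -z ^ 10 * Phi20 (Avec z) := by
  rw [Avec_neg_inv hz, Phi20_smul, Phi20_fourierVec, pow_mul _ 2 10, div_cpow_half_sq hz, div_pow,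
    mul_pow, show I ^ 10 = (I ^ 2) ^ 5 by ring, I_sq]
  ring

lemma Phi12_Avec_neg_inv {z : ℂ} (hz : 0 < z.im) :
    Phi12 (Avec (-1 / z)) = -z ^ 6 * Phi12 (Avec z) := by
  rw [Avec_neg_inv hz, Phi12_smul, Phi12_fourierVec, pow_mul _ 2 6, div_cpow_half_sq hz, div_pow,
    mul_pow, show I ^ 6 = (I ^ 2) ^ 3 by ring, I_sq]
  ring

lemma Phi30_Avec_neg_inv {z : ℂ} (hz : 0 < z.im) :
    Phi30 (Avec (-1 / z)) = -I * z ^ 15 * Phi30 (Avec z) := by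
  rw [Avec_neg_inv hz, Phi30_smul, Phi30_fourierVec, pow_mul _ 2 15, div_cpow_half_sq hz, div_pow,
    mul_pow, show I ^ 15 = (I ^ 2) ^ 7 * I by ring, I_sq]
  ring

lemma exp_five_eighths_pow_four : cexp (2 * Real.pi * I * (5 / 8)) ^ 4 = -1 := by
  rw [← Complex.exp_nat_mul, ← Complex.exp_pi_mul_I, Complex.exp_eq_exp_iff_exists_int]
  refine ⟨2, ?_⟩
  push_cast
  ring

lemma exp_five_eighths_pow_two : cexp (2 * Real.pi * I * (5 / 8)) ^ 2 = I := by
  rw [← Complex.exp_nat_mul]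
  refine Eq.trans ?_ Complex.exp_pi_div_two_mul_I
  rw [Complex.exp_eq_exp_iff_exists_int]
  refine ⟨1, ?_⟩
  push_cast
  ring

lemma Phi20_Avec_add_one (z : ℂ) : Phi20 (Avec (z + 1)) = -Phi20 (Avec z) := by
  rw [Avec_add_one, Phi20_smul, Phi20_torusVec, pow_mul _ 4 5, exp_five_eighths_pow_four]
  ring

lemma Phi12_Avec_add_one (z : ℂ) : Phi12 (Avec (z + 1)) = -Phi12 (Avec z) := by
  rw [Avec_add_one, Phi12_smul, Phi12_torusVec, pow_mul _ 4 3, exp_five_eighths_pow_four]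
  ring

lemma Phi30_Avec_add_one (z : ℂ) : Phi30 (Avec (z + 1)) = -I * Phi30 (Avec z) := by
  rw [Avec_add_one, Phi30_smul, Phi30_torusVec, pow_add _ 28 2, pow_mul _ 4 7,
    exp_five_eighths_pow_four, exp_five_eighths_pow_two]
  ring

/-! ### Behaviour of the invariants at the cusp -/

/-- The leading part of the theta constants at the cusp, in terms of `t = q^(1/104)`. -/
def leadingVec (t : ℂ) : Fin 6 → ℂ := ![0, t ^ 49, t ^ 25, -t ^ 9, 0, t]

/-- The leading part of `δ_ν` at the cusp. -/
def deltaLeading (y : ℂ) : ℂ := -1 + 2 * y + 2 * y ^ 2 - 2 * y ^ 3 - 8 * y ^ 4 + 6 * y ^ 5 + y ^ 6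

/-- The leading part of `φ_ν` at the cusp, where `w_ν = φ_ν²`. -/
def phiLeading (y : ℂ) : ℂ := -1 - y ^ 2 + y ^ 3 + 2 * y ^ 4

lemma Dinf_leadingVec (t : ℂ) : Dinf (leadingVec t) = 0 := by
  simp [Dinf, leadingVec]

lemma D_leadingVec (t : ℂ) :
    D 0 (leadingVec t) = 0 ∧
    D 1 (leadingVec t) = 3 * t ^ 99 ∧
    D 2 (leadingVec t) = -t ^ 3 - t ^ 107 ∧
    D 3 (leadingVec t) = t ^ 11 ∧
    D 4 (leadingVec t) = -2 * t ^ 19 - t ^ 123 ∧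
    D 5 (leadingVec t) = -t ^ 27 ∧
    D 6 (leadingVec t) = -t ^ 35 ∧
    D 7 (leadingVec t) = t ^ 43 - t ^ 147 ∧
    D 8 (leadingVec t) = 3 * t ^ 51 ∧
    D 9 (leadingVec t) = -2 * t ^ 59 ∧
    D 10 (leadingVec t) = t ^ 67 ∧
    D 11 (leadingVec t) = -4 * t ^ 75 ∧
    D 12 (leadingVec t) = t ^ 83 := by
  refine ⟨?_, ?_, ?_, ?_, ?_, ?_, ?_, ?_, ?_, ?_, ?_, ?_, ?_⟩ <;> simp [D, leadingVec] <;> ring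

lemma Gs_leadingVec (t : ℂ) :
    Gs 0 (leadingVec t) = 0 ∧
    Gs 1 (leadingVec t) = 9 * t ^ 86 + 4 * t ^ 190 - t ^ 294 ∧
    Gs 2 (leadingVec t) = -28 * t ^ 94 - 20 * t ^ 198 ∧
    Gs 3 (leadingVec t) = 7 * t ^ 102 + 6 * t ^ 206 ∧
    Gs 4 (leadingVec t) = -t ^ 6 - 6 * t ^ 110 + t ^ 214 ∧
    Gs 5 (leadingVec t) = 2 * t ^ 14 - 6 * t ^ 118 - 8 * t ^ 222 ∧
    Gs 6 (leadingVec t) = 2 * t ^ 22 + 34 * t ^ 126 + 4 * t ^ 230 ∧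
    Gs 7 (leadingVec t) = -2 * t ^ 30 - 20 * t ^ 134 ∧
    Gs 8 (leadingVec t) = -8 * t ^ 38 - 8 * t ^ 142 + 4 * t ^ 246 ∧
    Gs 9 (leadingVec t) = 6 * t ^ 46 - 36 * t ^ 150 ∧
    Gs 10 (leadingVec t) = t ^ 54 + 36 * t ^ 158 ∧
    Gs 11 (leadingVec t) = -8 * t ^ 62 - 8 * t ^ 166 - 2 * t ^ 270 ∧
    Gs 12 (leadingVec t) = 17 * t ^ 70 + 28 * t ^ 174 := by
  obtain ⟨h0, h1, h2, h3, h4, h5, h6, h7, h8, h9, h10, h11, h12⟩ := D_leadingVec t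
  refine ⟨?_, ?_, ?_, ?_, ?_, ?_, ?_, ?_, ?_, ?_, ?_, ?_, ?_⟩ <;>
    simp only [Gs, h0, h1, h2, h3, h4, h5, h6, h7, h8, h9, h10, h11, h12, Dinf_leadingVec] <;> ring

lemma deltaF_leadingVec (ν : ℕ) : ∃ R : ℂ → ℂ, Continuous R ∧
    ∀ t, deltaF ν (leadingVec t) = t ^ 6 *
      ((ζ ^ ν) ^ 4 * deltaLeading (ζ ^ ν * t ^ 8) + t ^ 56 * R t) := by
  refine ⟨fun t ↦ (fun x : ℂ ↦ x * (9 * t ^ 24 + 4 * t ^ 128 - t ^ 232) + x ^ 2 * (-28 * t ^ 32 - 20 * t ^ 136) + x ^ 3 * (7 *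
    t ^ 40 + 6 * t ^ 144) + x ^ 4 * (-6 * t ^ 48 + t ^ 152) + x ^ 5 * (-6 * t ^ 56 - 8 * t ^
    160) + x ^ 6 * (34 * t ^ 64 + 4 * t ^ 168) + x ^ 7 * (-20 * t ^ 72) + x ^ 8 * (-8 * t ^ 80 +
    4 * t ^ 184) + x ^ 9 * (-36 * t ^ 88) + x ^ 10 * (36 * t ^ 96) + x ^ 11 * (-8 - 8 * t ^ 104
    - 2 * t ^ 208) + x ^ 12 * (17 * t ^ 8 + 28 * t ^ 112)) (ζ ^ ν), by fun_prop, fun t ↦ ?_⟩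
  obtain ⟨h0, h1, h2, h3, h4, h5, h6, h7, h8, h9, h10, h11, h12⟩ := Gs_leadingVec t
  simp only [deltaF, pow_mul' ζ _ ν, deltaLeading]
  generalize ζ ^ ν = x
  simp only [Finset.sum_Icc_succ_top, Nat.reduceLeDiff, Nat.reduceAdd, Finset.Icc_self,
    Finset.sum_singleton, h0, h1, h2, h3, h4, h5, h6, h7, h8, h9, h10, h11, h12]
  ring

lemma deltaLeading_pow_two : ∃ Q : ℂ → ℂ, Continuous Q ∧ ∀ y, deltaLeading y ^ 2 =
    ∑ k ∈ range 6, [1, -4, 0, 12, 12, -52].getD k 0 * y ^ k + y ^ 6 * Q y := by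
  refine ⟨fun y ↦ -6 + 60 * y + 44 * y ^ 2 - 100 * y ^ 3 + 20 * y ^ 4 + 12 * y ^ 5 + y ^ 6, by fun_prop, fun y ↦ ?_⟩
  simp [deltaLeading, Finset.sum_range_succ]
  ring

lemma deltaLeading_pow_five : ∃ Q : ℂ → ℂ, Continuous Q ∧ ∀ y, deltaLeading y ^ 5 =
    ∑ k ∈ range 7, [-1, 10, -30, -10, 160, 142, -1315].getD k 0 * y ^ k + y ^ 7 * Q y := by
  refine ⟨fun y ↦ 280 + 4640 * y - 40 * y ^ 2 - 18288 * y ^ 3 + 5240 * y ^ 4 + 42430 * y ^ 5 - 4740 * y ^ 6 -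
    101820 * y ^ 7 + 27828 * y ^ 8 + 147760 * y ^ 9 - 20540 * y ^ 10 - 223870 * y ^ 11 + 79480 *
    y ^ 12 + 170672 * y ^ 13 - 47400 * y ^ 14 - 154720 * y ^ 15 + 99800 * y ^ 16 + 11395 * y ^
    17 - 16854 * y ^ 18 - 1750 * y ^ 19 + 1190 * y ^ 20 + 320 * y ^ 21 + 30 * y ^ 22 + y ^ 23, by fun_prop, fun y ↦ ?_⟩
  simp [deltaLeading, Finset.sum_range_succ]
  ring

lemma phiLeading_pow_ten : ∃ Q : ℂ → ℂ, Continuous Q ∧ ∀ y, phiLeading y ^ 10 =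
    ∑ k ∈ range 5, [1, 0, 10, -10, 25].getD k 0 * y ^ k + y ^ 5 * Q y := by
  refine ⟨fun y ↦ -90 - 15 * y - 180 * y ^ 2 + 30 * y ^ 3 + 480 * y ^ 4 + 552 * y ^ 5 + 1500 * y ^ 6 - 540 * y ^ 7
    - 2100 * y ^ 8 - 4710 * y ^ 9 - 6132 * y ^ 10 + 2355 * y ^ 11 + 9300 * y ^ 12 + 19240 * y ^
    13 + 15870 * y ^ 14 - 9773 * y ^ 15 - 30610 * y ^ 16 - 46415 * y ^ 17 - 23400 * y ^ 18 +
    31635 * y ^ 19 + 64188 * y ^ 20 + 65700 * y ^ 21 + 10550 * y ^ 22 - 61695 * y ^ 23 - 78010 *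
    y ^ 24 - 45923 * y ^ 25 + 17780 * y ^ 26 + 63060 * y ^ 27 + 46080 * y ^ 28 + 5280 * y ^ 29 -
    22656 * y ^ 30 - 26240 * y ^ 31 - 7680 * y ^ 32 + 6400 * y ^ 33 + 5120 * y ^ 34 + 1024 * y ^
    35, by fun_prop, fun y ↦ ?_⟩
  simp [phiLeading, Finset.sum_range_succ]
  ring

lemma sum_zeta13_pow (n : ℕ) : ∑ ν ∈ range 13, (ζ ^ ν) ^ n = if 13 ∣ n then 13 else 0 := by
  simp_rw [← pow_mul, mul_comm _ n, pow_mul]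
  split_ifs with h
  · obtain ⟨m, rfl⟩ := h
    simp [pow_mul, zeta13_pow_thirteen]
  · have h1 : ζ ^ n ≠ 1 := fun h' ↦ h (zeta13_isPrimitiveRoot.dvd_of_pow_eq_one n h')
    rw [geom_sum_eq h1, ← pow_mul, mul_comm, pow_mul, zeta13_pow_thirteen]
    simp

lemma sum_zeta13_expansion {a m : ℕ} (c : ℕ → ℂ) (h : ∀ k < m, ¬ 13 ∣ a + k) (hm : 13 ∣ a + m)
    (s : ℂ) : ∑ ν ∈ range 13, (ζ ^ ν) ^ a * ∑ k ∈ range (m + 1), c k * (ζ ^ ν * s) ^ k =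
      13 * c m * s ^ m := by
  have (ν : ℕ) : (ζ ^ ν) ^ a * ∑ k ∈ range (m + 1), c k * (ζ ^ ν * s) ^ k =
      ∑ k ∈ range (m + 1), c k * s ^ k * (ζ ^ ν) ^ (a + k) := by
    rw [Finset.mul_sum]
    refine Finset.sum_congr rfl fun k _ ↦ ?_
    ring
  simp_rw [this]
  rw [Finset.sum_comm]
  simp_rw [← Finset.mul_sum, sum_zeta13_pow]
  rw [Finset.sum_range_succ, if_pos hm, Finset.sum_eq_zero]
  · ring
  · intro k hk
    rw [if_neg (h k (Finset.mem_range.1 hk)), mul_zero]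

lemma exists_sum_eq_of_expansion {F : ℕ → ℂ → ℂ} {p : ℂ → ℂ} {a m d n e : ℕ} {c : ℕ → ℂ}
    (hp : ∃ Q : ℂ → ℂ, Continuous Q ∧ ∀ y, p y ^ n =
      ∑ k ∈ range (m + 1), c k * y ^ k + y ^ (m + 1) * Q y) (hpc : Continuous p)
    (hF : ∀ ν, ∃ R : ℂ → ℂ, Continuous R ∧ ∀ t, F ν t = t ^ d *
      ((ζ ^ ν) ^ a * p (ζ ^ ν * t ^ 8) + t ^ (8 * m + 1 + e) * R t))
    (h : ∀ k < m, ¬ 13 ∣ a * n + k) (hm : 13 ∣ a * n + m) :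
    ∃ K : ℂ → ℂ, Continuous K ∧ ∀ t, ∑ ν ∈ range 13, F ν t ^ n =
      t ^ (d * n + 8 * m) * (13 * c m + t * K t) := by
  obtain ⟨Q, hQ, hpQ⟩ := hp
  choose R hR hFR using hF
  have hpow (u v : ℂ) : (v + u) ^ n = u ^ n + v * ∑ i ∈ range n, (v + u) ^ i * u ^ (n - 1 - i) := by
    rw [← (Commute.all v u).geom_sum₂_mul_add n]
    ring
  refine ⟨fun t ↦ ∑ ν ∈ range 13, ((ζ ^ ν) ^ (a * n + m + 1) * t ^ 7 * Q (ζ ^ ν * t ^ 8) +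
    t ^ e * R ν t * ∑ i ∈ range n, (t ^ (8 * m + 1 + e) * R ν t +
      (ζ ^ ν) ^ a * p (ζ ^ ν * t ^ 8)) ^ i * ((ζ ^ ν) ^ a * p (ζ ^ ν * t ^ 8)) ^ (n - 1 - i)),
    by fun_prop, fun t ↦ ?_⟩
  have hterm (ν : ℕ) : F ν t ^ n = t ^ (d * n) * ((ζ ^ ν) ^ (a * n) *
      ∑ k ∈ range (m + 1), c k * (ζ ^ ν * t ^ 8) ^ k) + t ^ (d * n + 8 * m) * (t *
      ((ζ ^ ν) ^ (a * n + m + 1) * t ^ 7 * Q (ζ ^ ν * t ^ 8) +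
    t ^ e * R ν t * ∑ i ∈ range n, (t ^ (8 * m + 1 + e) * R ν t +
      (ζ ^ ν) ^ a * p (ζ ^ ν * t ^ 8)) ^ i * ((ζ ^ ν) ^ a * p (ζ ^ ν * t ^ 8)) ^ (n - 1 - i))) := by
    rw [hFR, mul_pow, add_comm (_ * p _), hpow, mul_pow _ (p _), hpQ]
    ring
  simp_rw [hterm]
  rw [Finset.sum_add_distrib, ← Finset.mul_sum, sum_zeta13_expansion c h hm, ← Finset.mul_sum,
    ← Finset.mul_sum]
  ring

lemma w_leadingVec (ν : ℕ) : ∃ R : ℂ → ℂ, Continuous R ∧ ∀ t, ∃ φ : ℂ, w ν (leadingVec t) = φ ^ 2 ∧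
    φ = t ^ 2 * ((ζ ^ ν) ^ 10 * phiLeading (ζ ^ ν * t ^ 8) + t ^ 48 * R t) := by
  refine ⟨fun t ↦ (fun x : ℂ ↦ -x ^ 3 + 2 * x ^ 4 * t ^ 8 + x ^ 9 * t ^ 48) (ζ ^ ν), by fun_prop,
    fun t ↦ ⟨_, ?_, rfl⟩⟩
  rw [w]
  congr 1
  simp only [pow_mul' ζ _ ν, phiLeading]
  have hx : (ζ ^ ν) ^ 13 = 1 := zeta13_pow_pow_thirteen ν
  generalize ζ ^ ν = x at hx
  simp [A, leadingVec]
  linear_combination -(2 * x * t ^ 34 + t ^ 26) * hx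

lemma exists_Phi30_leadingVec : ∃ K : ℂ → ℂ, Continuous K ∧
    ∀ t, Phi30 (leadingVec t) = t ^ 78 * (1 + t * K t) := by
  obtain ⟨K, hK, h⟩ := exists_sum_eq_of_expansion (e := 7) deltaLeading_pow_five
    (by unfold deltaLeading; fun_prop) deltaF_leadingVec (by decide) (by decide)
  refine ⟨fun t ↦ -(1 / (13 * 1315)) * K t, by fun_prop, fun t ↦ ?_⟩
  rw [Phi30, h t, deltaInf, (Gs_leadingVec t).1]
  simp
  ring

lemma exists_Phi12_leadingVec : ∃ K : ℂ → ℂ, Continuous K ∧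
    ∀ t, Phi12 (leadingVec t) = t ^ 52 * (1 + t * K t) := by
  obtain ⟨K, hK, h⟩ := exists_sum_eq_of_expansion (e := 15) deltaLeading_pow_two
    (by unfold deltaLeading; fun_prop) deltaF_leadingVec (by decide) (by decide)
  refine ⟨fun t ↦ -(1 / (13 * 52)) * K t, by fun_prop, fun t ↦ ?_⟩
  rw [Phi12, h t, deltaInf, (Gs_leadingVec t).1]
  simp
  ring

lemma exists_Phi20_leadingVec : ∃ K : ℂ → ℂ, Continuous K ∧
    ∀ t, Phi20 (leadingVec t) = t ^ 52 * (1 + t * K t) := by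
  choose R hR φ hw hφ using w_leadingVec
  obtain ⟨K, hK, h⟩ := exists_sum_eq_of_expansion (F := φ) (e := 15) phiLeading_pow_ten
    (by unfold phiLeading; fun_prop) (fun ν ↦ ⟨R ν, hR ν, hφ ν⟩) (by decide) (by decide)
  refine ⟨fun t ↦ 1 / (13 * 25) * (K t + 13 ^ 5 * t ^ 207), by fun_prop, fun t ↦ ?_⟩
  have h' : ∑ ν ∈ range 13, w ν (leadingVec t) ^ 5 = ∑ ν ∈ range 13, φ ν t ^ 10 := by
    refine Finset.sum_congr rfl fun ν _ ↦ ?_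
    rw [hw, ← pow_mul]
  have hinf : winf (leadingVec t) = 13 * t ^ 52 := by
    simp [winf, A, leadingVec]
    ring
  rw [Phi20, h', h t, hinf]
  simp
  ring

section Asymptotics

open UpperHalfPlane hiding I
open Filter Asymptotics Topology

lemma contDiff_A (j : ℕ) : ContDiff ℂ 1 (A j) := by
  rcases j with _ | _ | _ | _ | _ | _ | _ | j <;> change ContDiff ℂ 1 fun v ↦ A _ v <;>
    simp only [A] <;> fun_prop

lemma contDiff_D (j : ℕ) : ContDiff ℂ 1 (D j) := by
  rcases j with _ | _ | _ | _ | _ | _ | _ | _ | _ | _ | _ | _ | _ | j <;>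
    change ContDiff ℂ 1 fun v ↦ D _ v <;> simp only [D] <;> fun_prop

lemma contDiff_Dinf : ContDiff ℂ 1 Dinf := by
  unfold Dinf
  fun_prop

lemma contDiff_Gs (j : ℕ) : ContDiff ℂ 1 (Gs j) := by
  have := contDiff_D
  have := contDiff_Dinf
  rcases j with _ | _ | _ | _ | _ | _ | _ | _ | _ | _ | _ | _ | _ | j <;>
    change ContDiff ℂ 1 fun v ↦ Gs _ v <;> simp only [Gs] <;> fun_prop

lemma contDiff_Phi20 : ContDiff ℂ 1 Phi20 := by
  have := contDiff_A
  unfold Phi20 w winf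
  fun_prop

lemma contDiff_deltaF (ν : ℕ) : ContDiff ℂ 1 (deltaF ν) := by
  have := contDiff_Gs
  unfold deltaF
  fun_prop

lemma contDiff_deltaInf : ContDiff ℂ 1 deltaInf := by
  have := contDiff_Gs
  unfold deltaInf
  fun_prop

lemma contDiff_Phi12 : ContDiff ℂ 1 Phi12 := by
  have := contDiff_deltaF
  have := contDiff_deltaInf
  unfold Phi12
  fun_prop

lemma contDiff_Phi30 : ContDiff ℂ 1 Phi30 := by
  have := contDiff_deltaF
  have := contDiff_deltaInf
  unfold Phi30
  fun_prop

/-- The local parameter `q^(1/104)`. -/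
def rootParam (z : ℂ) : ℂ := cexp (2 * Real.pi * I * (z / 104))

lemma rootParam_ne_zero (z : ℂ) : rootParam z ≠ 0 := Complex.exp_ne_zero _

lemma rootParam_pow (n : ℕ) (z : ℂ) : rootParam z ^ n = cexp (2 * Real.pi * I * (n / 104) * z) := by
  rw [rootParam, ← Complex.exp_nat_mul]
  ring_nf

lemma norm_exp_two_pi_I_mul_real_mul (α : ℝ) (z : ℂ) :
    ‖cexp (2 * Real.pi * I * α * z)‖ = Real.exp (-2 * Real.pi * z.im * α) := by
  rw [Complex.norm_exp]
  simp
  ring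

lemma tendsto_rootParam : Tendsto (fun z : ℍ ↦ rootParam z) atImInfty (𝓝 0) := by
  have h (z : ℍ) : rootParam z = Function.Periodic.qParam 104 z := by
    rw [rootParam, Function.Periodic.qParam]
    push_cast
    ring_nf
  simp_rw [h]
  exact qParam_tendsto_atImInfty (by norm_num)

lemma summable_half_pow_natAbs : Summable fun n : ℤ ↦ (1 / 2 : ℝ) ^ n.natAbs := by
  refine Summable.of_nat_of_neg ?_ ?_ <;> simpa using summable_geometric_two

lemma isBigO_thetaSum_sub_one {c : ℤ} (hc : |c| ≤ 11) :
    (fun z : ℍ ↦ thetaSum c z - 1) =O[atImInfty] fun z ↦ rootParam z ^ 104 := by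
  obtain ⟨C, hC⟩ := summable_half_pow_natAbs.mul_left 2
  refine IsBigO.of_bound C ?_
  have hsmall : ∀ᶠ z : ℍ in atImInfty, ‖rootParam z ^ 104‖ < 1 / 2 := by
    have h := (tendsto_rootParam.pow 104).norm
    rw [zero_pow (by norm_num), norm_zero] at h
    exact h.eventually_lt_const (by norm_num)
  filter_upwards [hsmall] with z hz
  set r := ‖rootParam z ^ 104‖ with hr
  have hr' : r = Real.exp (-2 * Real.pi * z.im) := by
    rw [hr, rootParam_pow]
    simpa using norm_exp_two_pi_I_mul_real_mul 1 (z : ℂ)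
  have hr0 : 0 ≤ r := norm_nonneg _
  have hterm (n : ℤ) : ‖(-1 : ℂ) ^ n * qp ((13 * (n : ℚ) ^ 2 + (c : ℚ) * n) / 2) z‖ ≤
      r ^ n.natAbs := by
    rw [norm_mul, norm_zpow, norm_neg, norm_one, one_zpow, one_mul, qp, hr', ← Real.exp_nat_mul]
    have := norm_exp_two_pi_I_mul_real_mul (((13 * (n : ℚ) ^ 2 + (c : ℚ) * n) / 2 : ℚ) : ℝ) z
    rw [Complex.ofReal_ratCast] at this
    rw [this, Real.exp_le_exp, coe_im]
    have hn : (2 * n.natAbs : ℤ) ≤ 13 * n ^ 2 + c * n := by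
      have h1 := neg_abs_le (c * n)
      rw [abs_mul, Int.abs_eq_natAbs n] at h1
      have h2 : |c| * (n.natAbs : ℤ) ≤ 11 * n.natAbs := by gcongr
      have h3 : (n.natAbs : ℤ) ≤ n ^ 2 := by
        rw [← Int.natAbs_sq n]
        exact_mod_cast Nat.le_self_pow two_ne_zero _
      linarith
    have hn' : (2 * n.natAbs : ℝ) ≤ 13 * n ^ 2 + c * n := by
      have := (Int.cast_le (R := ℝ)).2 hn
      simpa only [Int.cast_mul, Int.cast_add, Int.cast_pow, Int.cast_ofNat, Int.cast_natCast]
        using this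
    have hy : 0 < Real.pi * z.im := mul_pos Real.pi_pos z.im_pos
    push_cast at hn' ⊢
    nlinarith
  have hterm' (n : ℤ) : ‖(-1 : ℂ) ^ n * qp ((13 * (n : ℚ) ^ 2 + (c : ℚ) * n) / 2) z -
      if n = 0 then 1 else 0‖ ≤ r * (2 * (1 / 2) ^ n.natAbs) := by
    split_ifs with h
    · subst h
      simpa [qp] using hr0
    · rw [sub_zero]
      refine (hterm n).trans ?_
      obtain ⟨m, hm⟩ := Nat.exists_eq_succ_of_ne_zero (Int.natAbs_ne_zero.2 h)
      rw [hm, pow_succ', pow_succ']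
      have : r ^ m ≤ (1 / 2) ^ m := by gcongr
      nlinarith
  have hs : Summable fun n : ℤ ↦ (-1 : ℂ) ^ n * qp ((13 * (n : ℚ) ^ 2 + (c : ℚ) * n) / 2) z := by
    refine Summable.of_norm_bounded (g := fun n : ℤ ↦ (1 / 2 : ℝ) ^ n.natAbs)
      summable_half_pow_natAbs fun n ↦ (hterm n).trans ?_
    gcongr
  have h1 : Summable fun n : ℤ ↦ if n = 0 then (1 : ℂ) else 0 :=
    (hasSum_ite_eq 0 (1 : ℂ)).summable
  have h2 : thetaSum c z - 1 = ∑' n : ℤ, ((-1 : ℂ) ^ n *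
      qp ((13 * (n : ℚ) ^ 2 + (c : ℚ) * n) / 2) z - if n = 0 then 1 else 0) := by
    rw [hs.tsum_sub h1, tsum_ite_eq, thetaSum]
  rw [h2, mul_comm C]
  exact tsum_of_norm_bounded (hC.mul_left r) hterm'

lemma isBigO_rootParam_pow {m n : ℕ} (h : n ≤ m) :
    (fun z : ℍ ↦ rootParam z ^ m) =O[atImInfty] fun z ↦ rootParam z ^ n := by
  have hsmall : ∀ᶠ z : ℍ in atImInfty, ‖rootParam z‖ < 1 := by
    have h := tendsto_rootParam.norm
    rw [norm_zero] at h
    exact h.eventually_lt_const one_pos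
  refine IsBigO.of_bound 1 ?_
  filter_upwards [hsmall] with z hz
  rw [norm_pow, norm_pow, one_mul]
  exact pow_le_pow_of_le_one (norm_nonneg _) hz.le h

lemma qp_eq_rootParam_pow (n : ℕ) (z : ℂ) : qp (n / 104) z = rootParam z ^ n := by
  rw [rootParam_pow, qp]
  push_cast
  rfl

lemma isBigO_thetaSum {c : ℤ} (hc : |c| ≤ 11) :
    (fun z : ℍ ↦ thetaSum c z) =O[atImInfty] fun _ ↦ (1 : ℂ) := by
  have h1 := (isBigO_thetaSum_sub_one hc).trans (isBigO_rootParam_pow (Nat.zero_le 104))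
  simp only [pow_zero] at h1
  simpa using h1.add (isBigO_refl (fun _ : ℍ ↦ (1 : ℂ)) atImInfty)

lemma isBigO_rootParam_pow_mul_thetaSum {c : ℤ} (hc : |c| ≤ 11) {m : ℕ} (hm : 79 ≤ m) :
    (fun z : ℍ ↦ rootParam z ^ m * thetaSum c z) =O[atImInfty] fun z ↦ rootParam z ^ 79 := by
  simpa using (isBigO_rootParam_pow hm).mul (isBigO_thetaSum hc)

lemma isBigO_rootParam_pow_mul_thetaSum_sub {c : ℤ} (hc : |c| ≤ 11) (m : ℕ) :
    (fun z : ℍ ↦ rootParam z ^ m * thetaSum c z - rootParam z ^ m) =O[atImInfty]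
      fun z ↦ rootParam z ^ 79 := by
  have h := (isBigO_refl (fun z : ℍ ↦ rootParam z ^ m) atImInfty).mul (isBigO_thetaSum_sub_one hc)
  simp only [← pow_add, mul_sub, mul_one] at h
  exact h.trans (isBigO_rootParam_pow (by omega))

lemma isBigO_Avec_sub_leadingVec :
    (fun z : ℍ ↦ Avec z - leadingVec (rootParam z)) =O[atImInfty] fun z ↦ rootParam z ^ 79 := by
  have hq (n : ℕ) (z : ℍ) := qp_eq_rootParam_pow n z
  have h1 := hq 121
  have h2 := hq 49
  have h3 := hq 25
  have h4 := hq 9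
  have h5 := hq 81
  have h6 := hq 1
  push_cast at h1 h2 h3 h4 h5 h6
  rw [forall_congr' fun z ↦ by rw [one_div]] at h6
  rw [isBigO_pi]
  intro i
  fin_cases i
  · simpa [Avec, thc, leadingVec, h1] using
      isBigO_rootParam_pow_mul_thetaSum (c := 11) (by norm_num) (m := 121) (by norm_num)
  · simpa [Avec, thc, leadingVec, h2] using
      isBigO_rootParam_pow_mul_thetaSum_sub (c := 7) (by norm_num) 49
  · simpa [Avec, thc, leadingVec, h3] using
      isBigO_rootParam_pow_mul_thetaSum_sub (c := 5) (by norm_num) 25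
  · have := (isBigO_rootParam_pow_mul_thetaSum_sub (c := 3) (by norm_num) 9).neg_left
    simpa [Avec, thc, leadingVec, h4, neg_add_eq_sub] using this
  · simpa [Avec, thc, leadingVec, h5] using
      isBigO_rootParam_pow_mul_thetaSum (c := 9) (by norm_num) (m := 81) (by norm_num)
  · simpa [Avec, thc, leadingVec, h6] using
      isBigO_rootParam_pow_mul_thetaSum_sub (c := 1) (by norm_num) 1

lemma tendsto_leadingVec : Tendsto (fun z : ℍ ↦ leadingVec (rootParam z)) atImInfty (𝓝 0) := by
  have h : Continuous leadingVec := by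
    refine continuous_pi fun i ↦ ?_
    fin_cases i <;> simp [leadingVec] <;> fun_prop
  have h0 : leadingVec 0 = 0 := by
    ext i
    fin_cases i <;> simp [leadingVec]
  have := (h.tendsto 0).comp tendsto_rootParam
  rwa [h0] at this

/-- A smooth form of leading order `t ^ n`, `n < 79`, on the leading vector has the same leading
order on the vector of theta constants. -/
lemma tendsto_form_Avec_div {F : (Fin 6 → ℂ) → ℂ} (hF : ContDiff ℂ 1 F) {n : ℕ} (hn : n < 79)
    (hlead : ∃ K : ℂ → ℂ, Continuous K ∧ ∀ t, F (leadingVec t) = t ^ n * (1 + t * K t)) :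
    Tendsto (fun z : ℍ ↦ F (Avec z) / rootParam z ^ n) atImInfty (𝓝 1) := by
  obtain ⟨K, hK, hFK⟩ := hlead
  have ht79 : Tendsto (fun z : ℍ ↦ rootParam z ^ 79) atImInfty (𝓝 0) := by
    simpa using tendsto_rootParam.pow 79
  have hA : Tendsto (fun z : ℍ ↦ Avec z) atImInfty (𝓝 0) := by
    simpa using (isBigO_Avec_sub_leadingVec.trans_tendsto ht79).add tendsto_leadingVec
  have hdiff : (fun z : ℍ ↦ F (Avec z) - F (leadingVec (rootParam z))) =O[atImInfty]
      fun z ↦ rootParam z ^ 79 := by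
    have h := (hF.contDiffAt.hasStrictFDerivAt (x := 0) one_ne_zero).isBigO_sub
    have hp := hA.prodMk_nhds tendsto_leadingVec
    exact (h.comp_tendsto hp).trans isBigO_Avec_sub_leadingVec
  have hsmall : Tendsto (fun z : ℍ ↦ (F (Avec z) - F (leadingVec (rootParam z))) /
      rootParam z ^ n) atImInfty (𝓝 0) := by
    have h := hdiff.mul (isBigO_refl (fun z : ℍ ↦ (rootParam z ^ n)⁻¹) atImInfty)
    have hlim : Tendsto (fun z : ℍ ↦ rootParam z ^ 79 * (rootParam z ^ n)⁻¹) atImInfty (𝓝 0) := by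
      have h0 : Tendsto (fun z : ℍ ↦ rootParam z ^ (79 - n)) atImInfty (𝓝 0) := by
        simpa [Nat.sub_ne_zero_of_lt hn] using tendsto_rootParam.pow (79 - n)
      refine h0.congr fun z ↦ ?_
      rw [pow_sub₀ _ (rootParam_ne_zero _) hn.le]
    simpa [div_eq_mul_inv] using h.trans_tendsto hlim
  have hmain : Tendsto (fun z : ℍ ↦ 1 + rootParam z * K (rootParam z)) atImInfty (𝓝 1) := by
    simpa using (tendsto_rootParam.mul ((hK.tendsto 0).comp tendsto_rootParam)).const_add 1
  have hsum := hsmall.add hmain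
  rw [zero_add] at hsum
  refine hsum.congr fun z ↦ ?_
  have := pow_ne_zero n (rootParam_ne_zero z)
  rw [hFK]
  field_simp
  ring

end Asymptotics

section LevelOne

open UpperHalfPlane hiding I
open Filter Topology MatrixGroups ModularForm

/-- A holomorphic function with the level one transformation laws and limit `1` at `i∞` is a
modular form. -/
lemma exists_modularForm_of_tendsto_one {k : ℤ} {f : ℂ → ℂ}
    (hf : ∀ z, 0 < z.im → DifferentiableAt ℂ f z)
    (hS : ∀ z, 0 < z.im → f (-1 / z) = z ^ k * f z)
    (hT : ∀ z, 0 < z.im → f (z + 1) = f z)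
    (hlim : Tendsto (fun z : ℍ ↦ f z) atImInfty (𝓝 1)) :
    ∃ F : ModularForm 𝒮ℒ k, (∀ z : ℍ, F z = f z) ∧ (qExpansion 1 F).coeff 0 = 1 := by
  have hS' : (fun z : ℍ ↦ f z) ∣[k] ModularGroup.S = fun z : ℍ ↦ f z := by
    ext z
    rw [SL_slash_apply, UpperHalfPlane.modular_S_smul, ModularGroup.denom_S]
    have h := hS z z.im_pos
    rw [neg_div, one_div] at h
    have hz := zpow_ne_zero k z.ne_zero
    simp only [zpow_neg]
    rw [← inv_neg] at h
    rw [h]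
    field_simp
  have hT' : (fun z : ℍ ↦ f z) ∣[k] ModularGroup.T = fun z : ℍ ↦ f z := by
    ext z
    rw [SL_slash_apply, UpperHalfPlane.modular_T_smul]
    have h := hT z z.im_pos
    rw [ModularGroup.denom_apply]
    simp [ModularGroup.T, add_comm (1 : ℂ), h]
  let F : ModularForm 𝒮ℒ k :=
    { toFun z := f z
      slash_action_eq' := by
        rintro _ ⟨γ, rfl⟩
        exact SlashInvariantForm.slash_action_generators_SL2Z hS' hT' γ
      holo' := by
        rw [UpperHalfPlane.mdifferentiable_iff]
        refine .congr (fun z hz ↦ (hf z hz).differentiableWithinAt) fun z hz ↦ ?_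
        simp [ofComplex_apply_of_im_pos hz]
      bdd_at_cusps' {c} hc := by
        rw [Subgroup.IsArithmetic.isCusp_iff_isCusp_SL2Z] at hc
        rw [OnePoint.isBoundedAt_iff_forall_SL2Z hc]
        intro γ _
        rw [SlashInvariantForm.slash_action_generators_SL2Z hS' hT' γ]
        exact hlim.isBigO_one ℝ }
  refine ⟨F, fun z ↦ rfl, ?_⟩
  rw [UpperHalfPlane.qExpansion_coeff_zero one_pos
    (ModularFormClass.analyticAt_cuspFunction_zero F one_pos one_mem_strictPeriods_SL)
    (SlashInvariantFormClass.periodic_comp_ofComplex F one_mem_strictPeriods_SL)]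
  exact hlim.limUnder_eq

/-- In weight less than twelve, a level one modular form is determined by its constant term. -/
lemma modularForm_eq_of_coeff_zero_eq {k : ℤ} (hk : k < 12) {F G : ModularForm 𝒮ℒ k}
    (h : (qExpansion 1 F).coeff 0 = (qExpansion 1 G).coeff 0) : F = G := by
  have hcusp : IsCuspForm (F - G) := by
    rw [isCuspForm_iff_coeffZero_eq_zero, FunLike.coe_sub,
      ModularForm.qExpansion_sub one_pos one_mem_strictPeriods_SL, map_sub, h, sub_self]
  obtain ⟨g, hg⟩ := hcusp
  have h0 : g = 0 := rank_zero_iff_forall_zero.1 (CuspForm.rank_eq_zero_of_weight_lt_twelve hk) g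
  rw [h0, map_zero] at hg
  exact sub_eq_zero.1 hg.symm

lemma eq_one_of_level_one {f : ℂ → ℂ} (hf : ∀ z, 0 < z.im → DifferentiableAt ℂ f z)
    (hS : ∀ z, 0 < z.im → f (-1 / z) = f z) (hT : ∀ z, 0 < z.im → f (z + 1) = f z)
    (hlim : Tendsto (fun z : ℍ ↦ f z) atImInfty (𝓝 1)) (z : ℍ) : f z = 1 := by
  obtain ⟨F, hF, hF0⟩ := exists_modularForm_of_tendsto_one (k := 0) hf
    (fun z hz ↦ by rw [zpow_zero, one_mul, hS z hz]) hT hlim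
  obtain ⟨G, hG, hG0⟩ := exists_modularForm_of_tendsto_one (k := 0) (f := fun _ ↦ 1)
    (by simp) (by simp) (by simp) tendsto_const_nhds
  rw [← hF, modularForm_eq_of_coeff_zero_eq (by norm_num) (hF0.trans hG0.symm), hG]

lemma eq_E₄_of_level_one {f : ℂ → ℂ} (hf : ∀ z, 0 < z.im → DifferentiableAt ℂ f z)
    (hS : ∀ z, 0 < z.im → f (-1 / z) = z ^ 4 * f z) (hT : ∀ z, 0 < z.im → f (z + 1) = f z)
    (hlim : Tendsto (fun z : ℍ ↦ f z) atImInfty (𝓝 1)) (z : ℍ) : f z = E₄ z := by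
  obtain ⟨F, hF, hF0⟩ := exists_modularForm_of_tendsto_one (k := 4) hf
    (fun z hz ↦ by rw [hS z hz]; norm_cast) hT hlim
  rw [← hF, modularForm_eq_of_coeff_zero_eq (by norm_num)
    (hF0.trans (EisensteinSeries.E_qExpansion_coeff_zero (k := 4) (by norm_num) ⟨2, rfl⟩).symm)]

lemma eq_E₆_of_level_one {f : ℂ → ℂ} (hf : ∀ z, 0 < z.im → DifferentiableAt ℂ f z)
    (hS : ∀ z, 0 < z.im → f (-1 / z) = z ^ 6 * f z) (hT : ∀ z, 0 < z.im → f (z + 1) = f z)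
    (hlim : Tendsto (fun z : ℍ ↦ f z) atImInfty (𝓝 1)) (z : ℍ) : f z = E₆ z := by
  obtain ⟨F, hF, hF0⟩ := exists_modularForm_of_tendsto_one (k := 6) hf
    (fun z hz ↦ by rw [hS z hz]; norm_cast) hT hlim
  rw [← hF, modularForm_eq_of_coeff_zero_eq (by norm_num)
    (hF0.trans (EisensteinSeries.E_qExpansion_coeff_zero (k := 6) (by norm_num) ⟨3, rfl⟩).symm)]

section Eta

lemma etaF_eq_eta (z : ℂ) : etaF z = ModularForm.eta z := by
  rw [etaF, ModularForm.eta, qp, Function.Periodic.qParam]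
  congr 1
  · push_cast
    ring_nf
  · simp_rw [eta_q_eq_pow]

lemma etaF_add_one (z : ℂ) : etaF (z + 1) = cexp (2 * Real.pi * I / 24) * etaF z := by
  rw [etaF, etaF, qp, qp, mul_add (2 * Real.pi * I : ℂ) z 1, mul_one, Complex.exp_add,
    Complex.exp_two_pi_mul_I, mul_one, ← mul_assoc, ← Complex.exp_add]
  push_cast
  ring_nf

lemma etaF_neg_inv_sq {z : ℂ} (hz : 0 < z.im) : etaF (-1 / z) ^ 2 = -I * z * etaF z ^ 2 := by
  have h := eta_comp_eq_csqrt_I_inv (show z ∈ upperHalfPlaneSet from hz)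
  have hsq (w : ℂ) : sqrt w ^ 2 = w := by
    simp [sqrt]
  simp only [Function.comp_apply, Pi.smul_apply, Pi.mul_apply, smul_eq_mul] at h
  rw [etaF_eq_eta, etaF_eq_eta, h, mul_pow, mul_pow, inv_pow, hsq, hsq, Complex.inv_I]
  ring

lemma etaF_ne_zero {z : ℂ} (hz : 0 < z.im) : etaF z ≠ 0 := by
  rw [etaF_eq_eta]
  exact eta_ne_zero hz

lemma differentiableAt_etaF {z : ℂ} (hz : 0 < z.im) : DifferentiableAt ℂ etaF z := by
  rw [funext etaF_eq_eta]
  exact differentiableAt_eta_of_mem_upperHalfPlaneSet hz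

lemma etaF_neg_inv_pow_twelve {z : ℂ} (hz : 0 < z.im) :
    etaF (-1 / z) ^ 12 = -z ^ 6 * etaF z ^ 12 := by
  rw [pow_mul _ 2 6, etaF_neg_inv_sq hz, mul_pow, mul_pow, neg_pow, show I ^ 6 = (I ^ 2) ^ 3 by ring,
    I_sq]
  ring

lemma etaF_neg_inv_pow_eighteen {z : ℂ} (hz : 0 < z.im) :
    etaF (-1 / z) ^ 18 = -I * z ^ 9 * etaF z ^ 18 := by
  rw [pow_mul _ 2 9, etaF_neg_inv_sq hz, mul_pow, mul_pow, neg_pow,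
    show I ^ 9 = (I ^ 2) ^ 4 * I by ring, I_sq]
  ring

lemma exp_pow_six : cexp (2 * Real.pi * I / 24) ^ 6 = I := by
  rw [← Complex.exp_nat_mul]
  refine Eq.trans ?_ Complex.exp_pi_div_two_mul_I
  push_cast
  ring_nf

lemma etaF_add_one_pow_twelve (z : ℂ) : etaF (z + 1) ^ 12 = -etaF z ^ 12 := by
  rw [etaF_add_one, mul_pow, pow_mul _ 6 2, exp_pow_six, I_sq]
  ring

lemma etaF_add_one_pow_eighteen (z : ℂ) : etaF (z + 1) ^ 18 = -I * etaF z ^ 18 := by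
  rw [etaF_add_one, mul_pow, pow_mul _ 6 3, exp_pow_six, I_pow_three]

lemma tendsto_tprod_one_sub_pow :
    Tendsto (fun q : ℂ ↦ ∏' n : ℕ, (1 - q ^ (n + 1))) (𝓝 0) (𝓝 1) := by
  have h := differentiableOn_tprod_one_sub_pow.continuousOn.continuousAt
    (Metric.ball_mem_nhds (0 : ℂ) one_pos)
  simpa [ContinuousAt] using h

/-- `η(z)^{6m}` has leading order `q^{m/4}`. -/
lemma tendsto_etaF_pow_div (m : ℕ) :
    Tendsto (fun z : ℍ ↦ etaF z ^ (6 * m) / rootParam z ^ (26 * m)) atImInfty (𝓝 1) := by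
  have h := ((tendsto_tprod_one_sub_pow.comp
    (f := fun z : ℍ ↦ rootParam z ^ 104) (by simpa using tendsto_rootParam.pow 104)).pow (6 * m))
  rw [one_pow] at h
  refine h.congr fun z ↦ ?_
  have hq : qp (1 / 24) z ^ (6 * m) = rootParam z ^ (26 * m) := by
    rw [pow_mul, pow_mul, qp, ← Complex.exp_nat_mul, rootParam_pow]
    congr 2
    push_cast
    ring
  have ht : rootParam z ^ 104 = cexp (2 * Real.pi * I * z) := by
    rw [rootParam_pow]
    norm_num
  rw [etaF, mul_pow, hq, Function.comp_apply, ht,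
    mul_div_cancel_left₀ _ (pow_ne_zero _ (rootParam_ne_zero z))]

end Eta

section Quotients

lemma differentiableAt_oddTheta (k : ℤ) {z : ℂ} (hz : 0 < z.im) :
    DifferentiableAt ℂ (oddTheta k) z := by
  rw [funext (oddTheta_eq_jacobiTheta₂ k)]
  have h := (hasFDerivAt_jacobiTheta₂ (1 / 2 + k * z / 2) (τ := 13 * z)
    (by simpa using hz)).differentiableAt
  have h2 : DifferentiableAt ℂ (fun z : ℂ ↦ (1 / 2 + k * z / 2, 13 * z)) z := by fun_prop
  have h3 := DifferentiableAt.comp (𝕜 := ℂ) z h h2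
  exact DifferentiableAt.mul (by fun_prop) h3

lemma differentiableAt_Avec {z : ℂ} (hz : 0 < z.im) : DifferentiableAt ℂ Avec z := by
  have := fun k ↦ differentiableAt_oddTheta k hz
  rw [funext Avec_eq_oddTheta, differentiableAt_pi]
  intro i
  fin_cases i <;> simp <;> fun_prop

lemma differentiableAt_form_Avec {F : (Fin 6 → ℂ) → ℂ} (hF : ContDiff ℂ 1 F) {z : ℂ}
    (hz : 0 < z.im) : DifferentiableAt ℂ (fun z ↦ F (Avec z)) z :=
  ((hF.differentiable one_ne_zero) (Avec z)).comp z (differentiableAt_Avec hz)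

lemma differentiableAt_form_Avec_div {F : (Fin 6 → ℂ) → ℂ} (hF : ContDiff ℂ 1 F) (n : ℕ) {z : ℂ}
    (hz : 0 < z.im) : DifferentiableAt ℂ (fun z ↦ F (Avec z) / etaF z ^ n) z :=
  (differentiableAt_form_Avec hF hz).div ((differentiableAt_etaF hz).pow n)
    (pow_ne_zero n (etaF_ne_zero hz))

lemma tendsto_form_Avec_div_etaF {F : (Fin 6 → ℂ) → ℂ} (hF : ContDiff ℂ 1 F) {m : ℕ} (hm : m ≤ 3)
    (hlead : ∃ K : ℂ → ℂ, Continuous K ∧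
      ∀ t, F (leadingVec t) = t ^ (26 * m) * (1 + t * K t)) :
    Tendsto (fun z : ℍ ↦ F (Avec z) / etaF z ^ (6 * m)) atImInfty (𝓝 1) := by
  have h := (tendsto_form_Avec_div hF (by omega) hlead).div (tendsto_etaF_pow_div m) one_ne_zero
  rw [div_one] at h
  refine h.congr fun z ↦ ?_
  exact div_div_div_cancel_right₀ (pow_ne_zero _ (rootParam_ne_zero z)) _ _

lemma Phi12_Avec_eq (z : ℍ) : Phi12 (Avec z) = etaF z ^ 12 := by
  refine (div_eq_one_iff_eq (pow_ne_zero 12 (etaF_ne_zero z.im_pos))).1 <|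
    eq_one_of_level_one (f := fun z ↦ Phi12 (Avec z) / etaF z ^ 12)
      (fun z hz ↦ differentiableAt_form_Avec_div contDiff_Phi12 12 hz) (fun z hz ↦ ?_)
      (fun z hz ↦ ?_)
      (tendsto_form_Avec_div_etaF contDiff_Phi12 (m := 2) (by norm_num) exists_Phi12_leadingVec) z
  · have hz0 : z ≠ 0 := by
      rintro rfl
      simp at hz
    rw [Phi12_Avec_neg_inv hz, etaF_neg_inv_pow_twelve hz]
    exact mul_div_mul_left _ _ (neg_ne_zero.2 (pow_ne_zero 6 hz0))
  · rw [Phi12_Avec_add_one, etaF_add_one_pow_twelve, neg_div_neg_eq]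

lemma Phi20_Avec_eq (z : ℍ) : Phi20 (Avec z) = etaF z ^ 12 * E₄ z := by
  have hη := pow_ne_zero 12 (etaF_ne_zero z.im_pos)
  refine (div_eq_iff hη).1 (eq_E₄_of_level_one (f := fun z ↦ Phi20 (Avec z) / etaF z ^ 12)
      (fun z hz ↦ differentiableAt_form_Avec_div contDiff_Phi20 12 hz) (fun z hz ↦ ?_)
      (fun z hz ↦ ?_)
      (tendsto_form_Avec_div_etaF contDiff_Phi20 (m := 2) (by norm_num) exists_Phi20_leadingVec) z)
    |>.trans (mul_comm _ _)
  · have hz0 : z ≠ 0 := by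
      rintro rfl
      simp at hz
    have := pow_ne_zero 12 (etaF_ne_zero hz)
    rw [Phi20_Avec_neg_inv hz, etaF_neg_inv_pow_twelve hz]
    field_simp
  · rw [Phi20_Avec_add_one, etaF_add_one_pow_twelve, neg_div_neg_eq]

lemma Phi30_Avec_eq (z : ℍ) : Phi30 (Avec z) = etaF z ^ 18 * E₆ z := by
  have hη := pow_ne_zero 18 (etaF_ne_zero z.im_pos)
  refine (div_eq_iff hη).1 (eq_E₆_of_level_one (f := fun z ↦ Phi30 (Avec z) / etaF z ^ 18)
      (fun z hz ↦ differentiableAt_form_Avec_div contDiff_Phi30 18 hz) (fun z hz ↦ ?_)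
      (fun z hz ↦ ?_)
      (tendsto_form_Avec_div_etaF contDiff_Phi30 (m := 3) (by norm_num) exists_Phi30_leadingVec) z)
    |>.trans (mul_comm _ _)
  · have hz0 : z ≠ 0 := by
      rintro rfl
      simp at hz
    have := pow_ne_zero 18 (etaF_ne_zero hz)
    rw [Phi30_Avec_neg_inv hz, etaF_neg_inv_pow_eighteen hz]
    field_simp
  · rw [Phi30_Avec_add_one, etaF_add_one_pow_eighteen,
      mul_div_mul_left _ _ (neg_ne_zero.2 I_ne_zero)]

lemma X_eq_smul (z : ℂ) : X z = etaF z • Avec z := rfl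

lemma Phi_relation (z : ℍ) :
    Phi20 (X z) ^ 3 - Phi30 (X z) ^ 2 = 1728 * Phi12 (X z) ^ 5 := by
  have h := discriminant_eq_E₄_cube_sub_E₆_sq z
  rw [discriminant, ← etaF_eq_eta] at h
  rw [X_eq_smul, Phi20_smul, Phi30_smul, Phi12_smul, Phi20_Avec_eq, Phi30_Avec_eq, Phi12_Avec_eq]
  linear_combination (-1728 * etaF z ^ 96) * h

end Quotients

end LevelOne

/-- the equation of the `E8`-singularity from `X(13)`:
`Φ20³ − Φ30² = 1728·Φ12⁵` at `(x1(z),…,x6(z))`. -/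
theorem stmt_18 (z : ℂ) (hz : 0 < z.im) :
    Phi20 (X z) ^ 3 - Phi30 (X z) ^ 2 = 1728 * Phi12 (X z) ^ 5 :=
  Phi_relation ⟨z, hz⟩

end
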